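/- arXiv:2210.15175 — 2 statements merged into one kernel-verified Lean document; each statement's English description precedes it below -/
import Mathlib

section
/- There is a universal constant C > 0 such that the following holds. Let X = {1,...,m} with the usual total order, m ≥ 2, let ℓ : [0,1]×[0,1] → ℝ≥0 be an L-Lipschitz loss function, let L_f > 0, let n ≥ 2 and ε ∈ (0,1]. Then there exists a randomized algorithm M mapping each dataset D ∈ (X×[0,1])^n to a probability distribution over functions f : X → [0,1] that are monotone and L_f-Lipschitz, such that M is ε-differentially private and for every dataset D, E_{f∼M(D)}[L_ℓ(f;D)] − min over monotone L_f-Lipschitz g : X → [0,1] of L_ℓ(g;D) is at most C · L · log(nm) · (1 + log²(εn)) / (εn). -/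
open MeasureTheory

noncomputable section

/-- The (normalized) empirical risk of `f` on dataset `D` with loss `ℓ`. -/
def empRisk {X : Type*} (ℓ : ℝ → ℝ → ℝ) {n : ℕ} (f : X → ℝ) (D : Fin n → X × ℝ) : ℝ :=
  (1 / (n : ℝ)) * ∑ i, ℓ (f (D i).1) (D i).2

/-- A valid dataset: all labels lie in `[0,1]`. -/
def IsDataset {X : Type*} {n : ℕ} (D : Fin n → X × ℝ) : Prop :=
  ∀ i, (D i).2 ∈ Set.Icc (0 : ℝ) 1

/-- Two (valid) datasets are neighboring if they differ in at most one entry. -/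
def NeighborDS {X : Type*} {n : ℕ} (D D' : Fin n → X × ℝ) : Prop :=
  IsDataset D ∧ IsDataset D' ∧ ∃ i, ∀ j, j ≠ i → D j = D' j

/-- A monotone function on the poset `X` taking values in `[0,1]`. -/
def IsMonotone01 {X : Type*} [PartialOrder X] (f : X → ℝ) : Prop :=
  Monotone f ∧ ∀ x, f x ∈ Set.Icc (0 : ℝ) 1

/-- The optimal empirical risk over all monotone `[0,1]`-valued functions. -/
def optRisk {X : Type*} [PartialOrder X] (ℓ : ℝ → ℝ → ℝ) {n : ℕ} (D : Fin n → X × ℝ) : ℝ :=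
  ⨅ g : {g : X → ℝ // IsMonotone01 g}, empRisk ℓ g.1 D

/-- `(ε, δ)`-differential privacy of a mechanism `M` w.r.t. a neighboring relation. -/
def IsDP {I Ω : Type*} [MeasurableSpace Ω] (Neighbor : I → I → Prop)
    (M : I → Measure Ω) (ε δ : ℝ) : Prop :=
  ∀ D D', Neighbor D D' → ∀ S : Set Ω, MeasurableSet S →
    M D S ≤ ENNReal.ofReal (Real.exp ε) * M D' S + ENNReal.ofReal δ

/-- A loss function `ℓ : [0,1] × [0,1] → ℝ≥0` that is `L`-Lipschitz in its first argument. -/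
def IsLipschitzLoss (ℓ : ℝ → ℝ → ℝ) (L : ℝ) : Prop :=
  (∀ y z : ℝ, y ∈ Set.Icc (0:ℝ) 1 → z ∈ Set.Icc (0:ℝ) 1 → 0 ≤ ℓ y z) ∧
  (∀ y y' z : ℝ, y ∈ Set.Icc (0:ℝ) 1 → y' ∈ Set.Icc (0:ℝ) 1 → z ∈ Set.Icc (0:ℝ) 1 →
    |ℓ y z - ℓ y' z| ≤ L * |y - y'|)

/-- An `R`-distance-based loss function: `ℓ(y,y') = g(|y - y'|)` for a non-decreasing
nonnegative `g` with `g 0 = 0` and `g (1/2) ≥ R`. -/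
def IsDistanceBasedLoss (ℓ : ℝ → ℝ → ℝ) (R : ℝ) : Prop :=
  ∃ g : ℝ → ℝ, MonotoneOn g (Set.Icc (0:ℝ) 1) ∧ (∀ t ∈ Set.Icc (0:ℝ) 1, 0 ≤ g t) ∧
    g 0 = 0 ∧ R ≤ g (1 / 2) ∧
    ∀ y y' : ℝ, y ∈ Set.Icc (0:ℝ) 1 → y' ∈ Set.Icc (0:ℝ) 1 → ℓ y y' = g |y - y'|

/-- The width of a poset: the largest size of an antichain. -/
def posetWidth (X : Type*) [PartialOrder X] : ℕ :=
  sSup {k | ∃ A : Finset X, IsAntichain (· ≤ ·) (A : Set X) ∧ A.card = k}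

/-- An isotonic-regression mechanism: on each valid dataset it outputs a probability
distribution supported on monotone `[0,1]`-valued functions. -/
def IsIsoRegAlg {X : Type*} [PartialOrder X] {n : ℕ}
    (M : (Fin n → X × ℝ) → Measure (X → ℝ)) : Prop :=
  ∀ D : Fin n → X × ℝ, IsDataset D →
    IsProbabilityMeasure (M D) ∧ M D {f | IsMonotone01 f} = 1

/-- `f : {1,…,m} → ℝ` is `Lf`-Lipschitz (w.r.t. the integer distance on the domain). -/
def IsLipFun (Lf : ℝ) {m : ℕ} (f : Fin m → ℝ) : Prop :=
  ∀ x y : Fin m, |f x - f y| ≤ Lf * |(x : ℝ) - (y : ℝ)|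

/-- The Gibbs distribution with inverse temperature `lam` and energy `u` on a finite type: the
output distribution of the exponential mechanism. -/
def gibbsWeight {κ : Type*} [Fintype κ] (lam : ℝ) (u : κ → ℝ) (j : κ) : ℝ :=
  Real.exp (-(lam * u j)) / ∑ k, Real.exp (-(lam * u k))

section Gibbs

variable {κ : Type*} [Fintype κ] [Nonempty κ]

lemma sum_exp_pos (v : κ → ℝ) : 0 < ∑ k, Real.exp (v k) :=
  Finset.sum_pos (fun _ _ => Real.exp_pos _) Finset.univ_nonempty

lemma gibbsWeight_pos (lam : ℝ) (u : κ → ℝ) (j : κ) : 0 < gibbsWeight lam u j :=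
  div_pos (Real.exp_pos _) (sum_exp_pos _)

lemma sum_gibbsWeight (lam : ℝ) (u : κ → ℝ) : ∑ j, gibbsWeight lam u j = 1 := by
  unfold gibbsWeight
  rw [← Finset.sum_div]
  exact div_self (sum_exp_pos _).ne'

/-- Energies that agree up to an additive constant and an error `s` have Gibbs distributions
within a factor `exp (2 * lam * s)`. -/
lemma gibbsWeight_le_exp_mul {lam : ℝ} (hlam : 0 ≤ lam) {u v : κ → ℝ} {c s : ℝ}
    (h : ∀ j, |u j - v j - c| ≤ s) (j : κ) :
    gibbsWeight lam u j ≤ Real.exp (2 * lam * s) * gibbsWeight lam v j := by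
  unfold gibbsWeight
  have hu := sum_exp_pos (fun k => -(lam * u k))
  have hv := sum_exp_pos (fun k => -(lam * v k))
  have h1 : Real.exp (-(lam * u j)) ≤ Real.exp (lam * (s - c)) * Real.exp (-(lam * v j)) := by
    rw [← Real.exp_add, Real.exp_le_exp]
    nlinarith [mul_le_mul_of_nonneg_left (abs_le.1 (h j)).1 hlam]
  have h2 : ∑ k, Real.exp (-(lam * v k))
      ≤ Real.exp (lam * (s + c)) * ∑ k, Real.exp (-(lam * u k)) := by
    rw [Finset.mul_sum]
    refine Finset.sum_le_sum fun k _ => ?_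
    rw [← Real.exp_add, Real.exp_le_exp]
    nlinarith [mul_le_mul_of_nonneg_left (abs_le.1 (h k)).2 hlam]
  rw [← mul_div_assoc, div_le_div_iff₀ hu hv]
  calc Real.exp (-(lam * u j)) * ∑ k, Real.exp (-(lam * v k))
      ≤ (Real.exp (lam * (s - c)) * Real.exp (-(lam * v j))) *
          (Real.exp (lam * (s + c)) * ∑ k, Real.exp (-(lam * u k))) :=
        mul_le_mul h1 h2 hv.le (by positivity)
    _ = Real.exp (2 * lam * s) * Real.exp (-(lam * v j)) * ∑ k, Real.exp (-(lam * u k)) := by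
        rw [show 2 * lam * s = lam * (s - c) + lam * (s + c) by ring, Real.exp_add]
        ring

/-- The entropy of a probability vector is at most the logarithm of the number of outcomes. -/
lemma sum_mul_neg_log_le_log_card {q : κ → ℝ} (hq : ∀ j, 0 < q j) (hsum : ∑ j, q j = 1) :
    ∑ j, q j * -Real.log (q j) ≤ Real.log (Fintype.card κ) := by
  have hN : (0 : ℝ) < Fintype.card κ := by exact_mod_cast Fintype.card_pos
  calc ∑ j, q j * -Real.log (q j)
      ≤ ∑ j, (q j * Real.log (Fintype.card κ) + (1 / Fintype.card κ - q j)) := by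
        refine Finset.sum_le_sum fun j _ => ?_
        have h := Real.log_le_sub_one_of_pos (inv_pos.2 (mul_pos hN (hq j)))
        rw [Real.log_inv, Real.log_mul hN.ne' (hq j).ne'] at h
        have h2 := mul_le_mul_of_nonneg_left h (hq j).le
        have h3 : q j * ((Fintype.card κ * q j)⁻¹ - 1) = 1 / Fintype.card κ - q j := by
          have := (hq j).ne'
          field_simp
        linarith
    _ = Real.log (Fintype.card κ) := by
        rw [Finset.sum_add_distrib, Finset.sum_sub_distrib, ← Finset.sum_mul, hsum]
        simp [hN.ne']

/-- Utility of the exponential mechanism. -/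
lemma sum_gibbsWeight_mul_le {lam : ℝ} (hlam : 0 < lam) (u : κ → ℝ) (k : κ) :
    ∑ j, gibbsWeight lam u j * u j ≤ u k + Real.log (Fintype.card κ) / lam := by
  have hZ := sum_exp_pos (fun k => -(lam * u k))
  have hlog : ∀ j, lam * u j
      = -Real.log (gibbsWeight lam u j) - Real.log (∑ k, Real.exp (-(lam * u k))) := by
    intro j
    unfold gibbsWeight
    rw [Real.log_div (Real.exp_pos _).ne' hZ.ne', Real.log_exp]
    ring
  have hk : -(lam * u k) ≤ Real.log (∑ k, Real.exp (-(lam * u k))) := by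
    rw [Real.le_log_iff_exp_le hZ]
    exact Finset.single_le_sum (f := fun k => Real.exp (-(lam * u k)))
      (fun _ _ => (Real.exp_pos _).le) (Finset.mem_univ k)
  have hent := sum_mul_neg_log_le_log_card (gibbsWeight_pos lam u) (sum_gibbsWeight lam u)
  have hE : lam * ∑ j, gibbsWeight lam u j * u j
      = ∑ j, gibbsWeight lam u j * -Real.log (gibbsWeight lam u j)
        - Real.log (∑ k, Real.exp (-(lam * u k))) := by
    calc lam * ∑ j, gibbsWeight lam u j * u j
        = ∑ j, gibbsWeight lam u j * (lam * u j) := by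
          rw [Finset.mul_sum]
          exact Finset.sum_congr rfl fun _ _ => by ring
      _ = ∑ j, (gibbsWeight lam u j * -Real.log (gibbsWeight lam u j)
            - gibbsWeight lam u j * Real.log (∑ k, Real.exp (-(lam * u k)))) :=
          Finset.sum_congr rfl fun j _ => by rw [hlog j, mul_sub]
      _ = _ := by rw [Finset.sum_sub_distrib, ← Finset.sum_mul, sum_gibbsWeight, one_mul]
  have : lam * ∑ j, gibbsWeight lam u j * u j
      ≤ lam * (u k + Real.log (Fintype.card κ) / lam) := by
    rw [hE, mul_add, mul_div_cancel₀ _ hlam.ne']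
    linarith
  exact le_of_mul_le_mul_left this hlam

end Gibbs

lemma sInf_image_le_add {Ω : Type*} {B : Set Ω} (hB : B.Nonempty) {r r' : Ω → ℝ} {c : ℝ}
    (hbdd : BddBelow (r '' B)) (h : ∀ f ∈ B, r f ≤ r' f + c) :
    sInf (r '' B) ≤ sInf (r' '' B) + c := by
  rw [← sub_le_iff_le_add]
  refine le_csInf (hB.image _) ?_
  rintro _ ⟨f, hf, rfl⟩
  have := csInf_le hbdd (Set.mem_image_of_mem r hf)
  linarith [h f hf]

/-- Hierarchical exponential mechanism: `k` rounds of choosing, within the current cell, a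
subcell of the next level by the exponential mechanism, followed by outputting an arbitrary
element of the last cell. -/
theorem exists_hierarchical_mechanism {𝒟 Ω : Type*} (R : 𝒟 → Ω → ℝ) (V : 𝒟 → Prop)
    (nb : 𝒟 → 𝒟 → Prop) (P : ℕ → Set Ω → Prop) (s d : ℕ → ℝ) (b η : ℝ)
    (hη : 0 < η) (hs : ∀ i, 0 < s i)
    (hV : ∀ D D', nb D D' → V D ∧ V D')
    (hsens : ∀ i A, P i A → ∀ f ∈ A, ∀ g ∈ A, ∀ D D', nb D D' →
      |(R D f - R D g) - (R D' f - R D' g)| ≤ s i)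
    (hdiam : ∀ i A, P i A → ∀ f ∈ A, ∀ g ∈ A, ∀ D, V D → R D f ≤ R D g + d i)
    (hcover : ∀ i A, P i A → ∃ (κ : Type) (_ : Fintype κ) (B : κ → Set Ω),
      (∀ j, (B j).Nonempty ∧ B j ⊆ A ∧ P (i + 1) (B j)) ∧ (∀ f ∈ A, ∃ j, f ∈ B j) ∧
      s i * Real.log (Fintype.card κ) ≤ b)
    (k i : ℕ) (A : Set Ω) (hA : P i A) (hne : A.Nonempty) :
    ∃ (ι : Type) (_ : Fintype ι) (p : 𝒟 → ι → ℝ) (rep : ι → Ω),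
      (∀ D a, 0 ≤ p D a) ∧ (∀ D, ∑ a, p D a = 1) ∧ (∀ a, rep a ∈ A) ∧
      (∀ D D', nb D D' → ∀ a, p D a ≤ Real.exp (k * η) * p D' a) ∧
      ∀ D, V D → ∀ g ∈ A,
        ∑ a, p D a * R D (rep a) ≤ R D g + (k * (2 * b / η) + d (i + k)) := by
  induction k generalizing i A with
  | zero =>
    obtain ⟨f, hf⟩ := hne
    refine ⟨Unit, inferInstance, fun _ _ => 1, fun _ => f, by simp, by simp, by simpa using hf,
      by simp, fun D hD g hg => ?_⟩
    simpa using hdiam i A hA f hf g hg D hD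
  | succ k ih =>
    obtain ⟨κ, _, B, hB, hcov, hcard⟩ := hcover i A hA
    obtain ⟨f₀, hf₀⟩ := hne
    have : Nonempty κ := (hcov f₀ hf₀).nonempty
    choose ι _ p rep hp0 hp1 hrep hpriv hutil using
      fun j => ih (i + 1) (B j) (hB j).2.2 (hB j).1
    set u : 𝒟 → κ → ℝ := fun D j => sInf (R D '' B j) with hu
    have hbdd : ∀ D, V D → ∀ j, BddBelow (R D '' B j) := by
      refine fun D hD j => ⟨R D f₀ - d i, ?_⟩
      rintro _ ⟨f, hf, rfl⟩
      linarith [hdiam i A hA f₀ hf₀ f ((hB j).2.1 hf) D hD]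
    set lam : ℝ := η / (2 * s i) with hlam
    have hlam0 : 0 < lam := div_pos hη (mul_pos two_pos (hs i))
    refine ⟨Σ j, ι j, inferInstance, fun D a => gibbsWeight lam (u D) a.1 * p a.1 D a.2,
      fun a => rep a.1 a.2, fun D a => mul_nonneg (gibbsWeight_pos _ _ _).le (hp0 _ _ _),
      fun D => ?_, fun a => (hB a.1).2.1 (hrep _ _), fun D D' hD a => ?_, fun D hD g hg => ?_⟩
    · rw [Fintype.sum_sigma]
      simp_rw [← Finset.mul_sum, hp1, mul_one]
      exact sum_gibbsWeight _ _
    · have hu1 : ∀ j, |u D j - u D' j - (R D f₀ - R D' f₀)| ≤ s i := by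
        intro j
        have hsj := fun f (hf : f ∈ B j) =>
          abs_le.1 (hsens i A hA f ((hB j).2.1 hf) f₀ hf₀ D D' hD)
        have h1 := sInf_image_le_add (r' := R D') (c := (R D f₀ - R D' f₀) + s i) (hB j).1
          (hbdd D (hV D D' hD).1 j) fun f hf => by linarith [(hsj f hf).2]
        have h2 := sInf_image_le_add (r' := R D) (c := -(R D f₀ - R D' f₀) + s i) (hB j).1
          (hbdd D' (hV D D' hD).2 j) fun f hf => by linarith [(hsj f hf).1]
        rw [abs_le]
        constructor <;> simp only [hu] <;> linarith
      have h2 : 2 * lam * s i = η := by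
        have := (hs i).ne'
        rw [hlam]
        field_simp
      have h3 := gibbsWeight_le_exp_mul hlam0.le hu1 a.1
      rw [h2] at h3
      have h4 := hpriv a.1 D D' hD a.2
      calc gibbsWeight lam (u D) a.1 * p a.1 D a.2
          ≤ (Real.exp η * gibbsWeight lam (u D') a.1) * (Real.exp (k * η) * p a.1 D' a.2) :=
            mul_le_mul h3 h4 (hp0 _ _ _)
              (mul_nonneg (Real.exp_pos _).le (gibbsWeight_pos _ _ _).le)
        _ = _ := by
            push_cast
            rw [add_mul, one_mul, Real.exp_add]
            ring
    · set E : ℝ := k * (2 * b / η) + d (i + 1 + k) with hE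
      have hinner : ∀ j, ∑ a, p j D a * R D (rep j a) ≤ u D j + E := by
        intro j
        rw [← sub_le_iff_le_add]
        refine le_csInf ((hB j).1.image _) ?_
        rintro _ ⟨f, hf, rfl⟩
        have := hutil j D hD f hf
        linarith
      obtain ⟨j₀, hj₀⟩ := hcov g hg
      have huj : u D j₀ ≤ R D g := csInf_le (hbdd D hD j₀) (Set.mem_image_of_mem _ hj₀)
      have hexp := sum_gibbsWeight_mul_le hlam0 (u D) j₀
      have hloss : Real.log (Fintype.card κ) / lam ≤ 2 * b / η := by
        rw [hlam, div_div_eq_mul_div, div_le_div_iff_of_pos_right hη]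
        linarith
      calc ∑ a : Σ j, ι j, gibbsWeight lam (u D) a.1 * p a.1 D a.2 * R D (rep a.1 a.2)
          = ∑ j, gibbsWeight lam (u D) j * ∑ a, p j D a * R D (rep j a) := by
            rw [Fintype.sum_sigma]
            simp_rw [Finset.mul_sum, mul_assoc]
        _ ≤ ∑ j, gibbsWeight lam (u D) j * (u D j + E) :=
            Finset.sum_le_sum fun j _ =>
              mul_le_mul_of_nonneg_left (hinner j) (gibbsWeight_pos _ _ _).le
        _ = ∑ j, gibbsWeight lam (u D) j * u D j + E := by
            simp_rw [mul_add]
            rw [Finset.sum_add_distrib, ← Finset.sum_mul, sum_gibbsWeight, one_mul]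
        _ ≤ R D g + (2 * b / η + E) := by linarith
        _ = _ := by
            rw [hE, show i + 1 + k = i + (k + 1) by ring]
            push_cast
            ring

/-- Number of points at which `f` is at least `(t + 1) / K`, for each `t < K`. -/
def levelCounts {m : ℕ} (K : ℕ) (f : Fin m → ℝ) (t : Fin K) : Fin (m + 1) :=
  ⟨(Finset.univ.filter fun x => ((t : ℝ) + 1) / K ≤ f x).card,
    Nat.lt_succ_of_le ((Finset.card_filter_le _ _).trans (by simp))⟩

lemma filter_le_eq_of_card_eq {m : ℕ} {f g : Fin m → ℝ} (hf : Monotone f) (hg : Monotone g)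
    {c : ℝ} (h : (Finset.univ.filter fun x => c ≤ f x).card
      = (Finset.univ.filter fun x => c ≤ g x).card) (x : Fin m) : c ≤ f x ↔ c ≤ g x := by
  have key : (Finset.univ.filter fun x => c ≤ f x) = Finset.univ.filter fun x => c ≤ g x := by
    have huf : IsUpperSet {x | c ≤ f x} := fun a b hab ha => le_trans ha (hf hab)
    have hug : IsUpperSet {x | c ≤ g x} := fun a b hab ha => le_trans ha (hg hab)
    rcases huf.total hug with hsub | hsub
    · exact Finset.eq_of_subset_of_card_le
        (fun y hy => by simpa using hsub (by simpa using hy)) h.ge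
    · exact (Finset.eq_of_subset_of_card_le
        (fun y hy => by simpa using hsub (by simpa using hy)) h.le).symm
  simpa using Finset.ext_iff.1 key x

lemma sub_le_of_levelCounts_eq {m K : ℕ} (hK : 0 < K) {f g : Fin m → ℝ} (hf : IsMonotone01 f)
    (hg : IsMonotone01 g) (h : levelCounts K f = levelCounts K g) (x : Fin m) :
    f x - g x ≤ 1 / K := by
  have hK' : (0 : ℝ) < K := by exact_mod_cast hK
  have hfx := hf.2 x
  have hgx := hg.2 x
  have hfl := Nat.floor_le (mul_nonneg hK'.le hfx.1)
  have hlt := Nat.lt_floor_add_one (K * f x)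
  rcases Nat.eq_zero_or_pos ⌊K * f x⌋₊ with h0 | hpos
  · rw [h0] at hlt
    have : f x ≤ 1 / K := by
      rw [le_div_iff₀ hK']
      push_cast at hlt
      linarith
    linarith [hgx.1]
  · obtain ⟨t, ht⟩ := Nat.exists_eq_succ_of_ne_zero hpos.ne'
    rw [ht] at hfl hlt
    push_cast at hfl hlt
    have htK : t < K := by
      have : ((t : ℝ) + 1) ≤ K := hfl.trans (by nlinarith [hfx.2])
      exact_mod_cast this
    have hcard := congrArg Fin.val (congrFun h ⟨t, htK⟩)
    have := (filter_le_eq_of_card_eq hf.1 hg.1 hcard x).1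
      (by rw [div_le_iff₀ hK']; simpa [mul_comm] using hfl)
    rw [div_le_iff₀ hK'] at this
    have h5 : K * (f x - g x) ≤ 1 := by simp at this; nlinarith
    rw [le_div_iff₀ hK']
    linarith

/-- A cell of the hierarchy: a set of monotone Lipschitz functions of sup-diameter `≤ 2⁻ⁱ`. -/
def IsLipCell (Lf : ℝ) {m : ℕ} (i : ℕ) (A : Set (Fin m → ℝ)) : Prop :=
  (∀ f ∈ A, IsMonotone01 f ∧ IsLipFun Lf f) ∧
    ∀ f ∈ A, ∀ g ∈ A, ∀ x, |f x - g x| ≤ (1 / 2) ^ i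

lemma IsLipCell.exists_cover {Lf : ℝ} {m i : ℕ} {A : Set (Fin m → ℝ)} (hA : IsLipCell Lf i A) :
    ∃ (κ : Type) (_ : Fintype κ) (B : κ → Set (Fin m → ℝ)),
      (∀ j, (B j).Nonempty ∧ B j ⊆ A ∧ IsLipCell Lf (i + 1) (B j)) ∧ (∀ f ∈ A, ∃ j, f ∈ B j) ∧
      Real.log (Fintype.card κ) ≤ 2 ^ (i + 1) * Real.log (m + 1) := by
  classical
  let cell : (Fin (2 ^ (i + 1)) → Fin (m + 1)) → Set (Fin m → ℝ) :=
    fun c => {f ∈ A | levelCounts (2 ^ (i + 1)) f = c}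
  refine ⟨{c // (cell c).Nonempty}, inferInstance, fun c => cell c.1,
    fun c => ⟨c.2, fun f hf => hf.1, fun f hf => hA.1 f hf.1, fun f hf g hg x => ?_⟩,
    fun f hf => ⟨⟨levelCounts _ f, f, hf, rfl⟩, hf, rfl⟩, ?_⟩
  · have hfg := hf.2.trans hg.2.symm
    have h1 := sub_le_of_levelCounts_eq (by positivity) (hA.1 f hf.1).1 (hA.1 g hg.1).1 hfg x
    have h2 := sub_le_of_levelCounts_eq (by positivity) (hA.1 g hg.1).1 (hA.1 f hf.1).1 hfg.symm x
    push_cast at h1 h2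
    rw [one_div_pow, abs_le]
    constructor <;> linarith
  · have hle : Fintype.card {c // (cell c).Nonempty} ≤ (m + 1) ^ 2 ^ (i + 1) :=
      (Fintype.card_subtype_le _).trans (by simp)
    have hpow : (2 : ℝ) ^ (i + 1) * Real.log (m + 1)
        = Real.log (((m + 1) ^ 2 ^ (i + 1) : ℕ) : ℝ) := by
      push_cast
      rw [Real.log_pow]
      push_cast
      rfl
    rw [hpow]
    rcases Nat.eq_zero_or_pos (Fintype.card {c // (cell c).Nonempty}) with h0 | hpos
    · rw [h0]
      rw [Nat.cast_zero, Real.log_zero]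
      exact Real.log_natCast_nonneg _
    · exact Real.log_le_log (by exact_mod_cast hpos) (by exact_mod_cast hle)

lemma empRisk_sub_le {X : Type*} {ℓ : ℝ → ℝ → ℝ} {L : ℝ} (hℓ : IsLipschitzLoss ℓ L)
    {n : ℕ} (hn : 0 < n) {f g : X → ℝ} {r : ℝ} (hL : 0 ≤ L)
    (hf : ∀ x, f x ∈ Set.Icc (0 : ℝ) 1) (hg : ∀ x, g x ∈ Set.Icc (0 : ℝ) 1)
    (hfg : ∀ x, |f x - g x| ≤ r) {D : Fin n → X × ℝ} (hD : IsDataset D) :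
    empRisk ℓ f D ≤ empRisk ℓ g D + L * r := by
  have hn' : (0 : ℝ) < n := by exact_mod_cast hn
  have h : ∑ i, ℓ (f (D i).1) (D i).2 ≤ ∑ i, (ℓ (g (D i).1) (D i).2 + L * r) := by
    refine Finset.sum_le_sum fun i _ => ?_
    have h1 := (abs_le.1 (hℓ.2 _ _ _ (hf (D i).1) (hg (D i).1) (hD i))).2
    have h2 := mul_le_mul_of_nonneg_left (hfg (D i).1) hL
    linarith
  rw [Finset.sum_add_distrib] at h
  unfold empRisk
  calc 1 / (n : ℝ) * ∑ i, ℓ (f (D i).1) (D i).2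
      ≤ 1 / (n : ℝ) * (∑ i, ℓ (g (D i).1) (D i).2 + ∑ _i : Fin n, L * r) :=
        mul_le_mul_of_nonneg_left h (by positivity)
    _ = _ := by
        simp only [Finset.sum_const, Finset.card_univ, Fintype.card_fin, nsmul_eq_mul]
        field_simp

lemma abs_empRisk_sub_sub_le {X : Type*} {ℓ : ℝ → ℝ → ℝ} {L : ℝ} (hℓ : IsLipschitzLoss ℓ L)
    {n : ℕ} {f g : X → ℝ} {r : ℝ} (hL : 0 ≤ L)
    (hf : ∀ x, f x ∈ Set.Icc (0 : ℝ) 1) (hg : ∀ x, g x ∈ Set.Icc (0 : ℝ) 1)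
    (hfg : ∀ x, |f x - g x| ≤ r) {D D' : Fin n → X × ℝ} (hD : NeighborDS D D') :
    |(empRisk ℓ f D - empRisk ℓ g D) - (empRisk ℓ f D' - empRisk ℓ g D')| ≤ 2 * L * r / n := by
  obtain ⟨hD, hD', i, hi⟩ := hD
  have hdiff : (empRisk ℓ f D - empRisk ℓ g D) - (empRisk ℓ f D' - empRisk ℓ g D')
      = 1 / (n : ℝ) * ((ℓ (f (D i).1) (D i).2 - ℓ (g (D i).1) (D i).2)
        - (ℓ (f (D' i).1) (D' i).2 - ℓ (g (D' i).1) (D' i).2)) := by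
    unfold empRisk
    rw [← mul_sub, ← mul_sub, ← mul_sub, ← Finset.sum_sub_distrib, ← Finset.sum_sub_distrib,
      ← Finset.sum_sub_distrib]
    rw [Finset.sum_eq_single i (fun j _ hj => by rw [hi j hj, sub_self]) (by simp)]
  have hone : ∀ E : Fin n → X × ℝ, IsDataset E →
      |ℓ (f (E i).1) (E i).2 - ℓ (g (E i).1) (E i).2| ≤ L * r := fun E hE =>
    (hℓ.2 _ _ _ (hf (E i).1) (hg (E i).1) (hE i)).trans
      (mul_le_mul_of_nonneg_left (hfg _) hL)
  rw [hdiff, abs_mul, abs_of_nonneg (by positivity : (0 : ℝ) ≤ 1 / n)]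
  calc _ ≤ 1 / (n : ℝ) * (L * r + L * r) :=
        mul_le_mul_of_nonneg_left
          ((abs_sub _ _).trans (add_le_add (hone D hD) (hone D' hD'))) (by positivity)
    _ = _ := by ring

section FiniteMixture

variable {ι Ω : Type*} [Fintype ι] [MeasurableSpace Ω]

/-- The law of `rep a`, where `a` is drawn with probability `p a`. -/
def finiteMixture (p : ι → ℝ) (rep : ι → Ω) : Measure Ω :=
  ∑ a, ENNReal.ofReal (p a) • Measure.dirac (rep a)

lemma finiteMixture_eq_one {p : ι → ℝ} (hp : ∀ a, 0 ≤ p a) (hsum : ∑ a, p a = 1)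
    {rep : ι → Ω} {S : Set Ω} (hS : ∀ a, rep a ∈ S) : finiteMixture p rep S = 1 := by
  simp only [finiteMixture, Measure.coe_finsetSum, Finset.sum_apply, Measure.smul_apply,
    smul_eq_mul]
  simp_rw [Measure.dirac_apply_of_mem (hS _), mul_one]
  rw [← ENNReal.ofReal_sum_of_nonneg fun a _ => hp a, hsum, ENNReal.ofReal_one]

lemma finiteMixture_le {p p' : ι → ℝ} {c : ℝ} (hc : 0 ≤ c) (h : ∀ a, p a ≤ c * p' a)
    (rep : ι → Ω) (S : Set Ω) :
    finiteMixture p rep S ≤ ENNReal.ofReal c * finiteMixture p' rep S := by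
  simp only [finiteMixture, Measure.coe_finsetSum, Finset.sum_apply, Measure.smul_apply,
    smul_eq_mul]
  rw [Finset.mul_sum]
  refine Finset.sum_le_sum fun a _ => ?_
  rw [← mul_assoc, ← ENNReal.ofReal_mul hc]
  gcongr
  exact h a

lemma integral_finiteMixture [MeasurableSingletonClass Ω] {p : ι → ℝ} (hp : ∀ a, 0 ≤ p a)
    (rep : ι → Ω) (φ : Ω → ℝ) : ∫ f, φ f ∂(finiteMixture p rep) = ∑ a, p a * φ (rep a) := by
  unfold finiteMixture
  rw [integral_finsetSum_measure fun a _ =>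
    (integrable_dirac (by simp)).smul_measure ENNReal.ofReal_ne_top]
  refine Finset.sum_congr rfl fun a _ => ?_
  rw [integral_smul_measure, integral_dirac, ENNReal.toReal_ofReal (hp a), smul_eq_mul]

end FiniteMixture

lemma isMonotone01_zero_and_isLipFun_zero {Lf : ℝ} {m : ℕ} (hLf : 0 ≤ Lf) :
    IsMonotone01 (fun _ : Fin m => (0 : ℝ)) ∧ IsLipFun Lf (fun _ : Fin m => (0 : ℝ)) :=
  ⟨⟨monotone_const, by simp⟩, fun x y => by simpa using mul_nonneg hLf (abs_nonneg _)⟩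

/-- A data-independent mechanism, useful when the privacy budget is too small to learn. -/
theorem exists_constant_mechanism {m : ℕ} {ℓ : ℝ → ℝ → ℝ} {L : ℝ}
    (hℓ : IsLipschitzLoss ℓ L) (hL : 0 ≤ L) {Lf : ℝ} (hLf : 0 ≤ Lf) {n : ℕ} (hn : 0 < n)
    {ε : ℝ} (hε : 0 ≤ ε) :
    ∃ M : (Fin n → Fin m × ℝ) → Measure (Fin m → ℝ),
      (∀ D : Fin n → Fin m × ℝ, IsDataset D →
        IsProbabilityMeasure (M D) ∧ M D {f | IsMonotone01 f ∧ IsLipFun Lf f} = 1) ∧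
      IsDP NeighborDS M ε 0 ∧
      ∀ D : Fin n → Fin m × ℝ, IsDataset D →
        (∫ f, empRisk ℓ f D ∂(M D)) -
          (⨅ g : {g : Fin m → ℝ // IsMonotone01 g ∧ IsLipFun Lf g}, empRisk ℓ g.1 D) ≤ L := by
  have hzero := isMonotone01_zero_and_isLipFun_zero (m := m) hLf
  refine ⟨fun _ => Measure.dirac fun _ => 0, fun D _ => ⟨inferInstance, ?_⟩,
    fun D D' _ S _ => ?_, fun D hD => ?_⟩
  · exact Measure.dirac_apply_of_mem hzero
  · rw [ENNReal.ofReal_zero, add_zero]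
    exact le_mul_of_one_le_left zero_le (by simpa using hε)
  · rw [integral_dirac, sub_le_comm]
    have : Nonempty {g : Fin m → ℝ // IsMonotone01 g ∧ IsLipFun Lf g} := ⟨⟨_, hzero⟩⟩
    refine le_ciInf fun g => ?_
    have h := empRisk_sub_le hℓ hn hL hzero.1.2 g.2.1.2 (r := 1) (fun x => by
      have := g.2.1.2 x
      rw [zero_sub, abs_neg, abs_of_nonneg this.1]
      exact this.2) hD
    linarith

/-- The hierarchical mechanism with `T` rounds for monotone `Lf`-Lipschitz regression. -/
theorem exists_lipschitz_isotonic_mechanism {m : ℕ} {ℓ : ℝ → ℝ → ℝ} {L : ℝ}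
    (hℓ : IsLipschitzLoss ℓ L) (hL : 0 < L) {Lf : ℝ} (hLf : 0 ≤ Lf) {n : ℕ} (hn : 0 < n)
    {η : ℝ} (hη : 0 < η) (T : ℕ) :
    ∃ M : (Fin n → Fin m × ℝ) → Measure (Fin m → ℝ),
      (∀ D : Fin n → Fin m × ℝ, IsDataset D →
        IsProbabilityMeasure (M D) ∧ M D {f | IsMonotone01 f ∧ IsLipFun Lf f} = 1) ∧
      IsDP NeighborDS M (T * η) 0 ∧
      ∀ D : Fin n → Fin m × ℝ, IsDataset D →
        (∫ f, empRisk ℓ f D ∂(M D)) -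
          (⨅ g : {g : Fin m → ℝ // IsMonotone01 g ∧ IsLipFun Lf g}, empRisk ℓ g.1 D) ≤
          T * (8 * L * Real.log (m + 1) / (n * η)) + L * (1 / 2) ^ T := by
  have hn' : (0 : ℝ) < n := by exact_mod_cast hn
  have hzero := isMonotone01_zero_and_isLipFun_zero (m := m) hLf
  have hroot : IsLipCell Lf 0 {f : Fin m → ℝ | IsMonotone01 f ∧ IsLipFun Lf f} := by
    refine ⟨fun f hf => hf, fun f hf g hg x => ?_⟩
    have h1 := hf.1.2 x
    have h2 := hg.1.2 x
    rw [pow_zero, abs_le]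
    constructor <;> linarith [h1.1, h1.2, h2.1, h2.2]
  obtain ⟨ι, _, p, rep, hp0, hp1, hrep, hpriv, hutil⟩ := exists_hierarchical_mechanism
    (𝒟 := Fin n → Fin m × ℝ) (fun D f => empRisk ℓ f D) IsDataset NeighborDS (IsLipCell Lf)
    (fun i => 2 * L * (1 / 2) ^ i / n) (fun i => L * (1 / 2) ^ i)
    (4 * L * Real.log (m + 1) / n) η hη (fun i => by positivity) (fun D D' h => ⟨h.1, h.2.1⟩)
    (fun i A hA f hf g hg D D' hD => abs_empRisk_sub_sub_le hℓ hL.le (hA.1 f hf).1.2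
      (hA.1 g hg).1.2 (hA.2 f hf g hg) hD)
    (fun i A hA f hf g hg D hD => empRisk_sub_le hℓ hn hL.le (hA.1 f hf).1.2
      (hA.1 g hg).1.2 (hA.2 f hf g hg) hD)
    (fun i A hA => by
      obtain ⟨κ, inst, B, h1, h2, h3⟩ := hA.exists_cover
      refine ⟨κ, inst, B, h1, h2, ?_⟩
      calc 2 * L * (1 / 2) ^ i / n * Real.log (Fintype.card κ)
          ≤ 2 * L * (1 / 2) ^ i / n * (2 ^ (i + 1) * Real.log (m + 1)) :=
            mul_le_mul_of_nonneg_left h3 (by positivity)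
        _ = 4 * L * Real.log (m + 1) / n := by
            rw [one_div_pow, pow_succ]
            field_simp
            ring)
    T 0 _ hroot ⟨_, hzero⟩
  refine ⟨fun D => finiteMixture (p D) rep, fun D _ => ⟨⟨?_⟩, ?_⟩, fun D D' hD S _ => ?_,
    fun D hD => ?_⟩
  · exact finiteMixture_eq_one (hp0 D) (hp1 D) fun _ => Set.mem_univ _
  · exact finiteMixture_eq_one (hp0 D) (hp1 D) hrep
  · simpa using finiteMixture_le (Real.exp_pos _).le (hpriv D D' hD) rep S
  · rw [integral_finiteMixture (hp0 D), sub_le_comm]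
    have : Nonempty {g : Fin m → ℝ // IsMonotone01 g ∧ IsLipFun Lf g} := ⟨⟨_, hzero⟩⟩
    refine le_ciInf fun g => ?_
    have h := hutil D hD g.1 g.2
    rw [zero_add] at h
    have h2 : 2 * (4 * L * Real.log (m + 1) / n) / η = 8 * L * Real.log (m + 1) / (n * η) := by
      field_simp
      ring
    rw [h2] at h
    linarith

/-- **Lipschitz isotonic regression (Theorem 5, Lipschitz case).** There is a universal
constant `C > 0` such that for `X = {1,…,m}` (here `Fin m`) with `m ≥ 2`, any
`L`-Lipschitz loss `ℓ`, any `L_f > 0`, `n ≥ 2` and `ε ∈ (0,1]`, there is an `ε`-DP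
mechanism outputting monotone `L_f`-Lipschitz functions whose expected excess empirical
risk relative to the best monotone `L_f`-Lipschitz function is at most
`C · L · log(nm) · (1 + log²(εn)) / (εn)`. -/
theorem dp_lipschitz_isotonic_regression_upper_bound :
    ∃ C : ℝ, 0 < C ∧
      ∀ m : ℕ, 2 ≤ m →
        ∀ (ℓ : ℝ → ℝ → ℝ) (L : ℝ), IsLipschitzLoss ℓ L →
        ∀ Lf : ℝ, 0 < Lf →
        ∀ n : ℕ, 2 ≤ n →
        ∀ ε : ℝ, ε ∈ Set.Ioc (0 : ℝ) 1 →
        ∃ M : (Fin n → Fin m × ℝ) → Measure (Fin m → ℝ),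
          (∀ D : Fin n → Fin m × ℝ, IsDataset D →
            IsProbabilityMeasure (M D) ∧ M D {f | IsMonotone01 f ∧ IsLipFun Lf f} = 1) ∧
          IsDP NeighborDS M ε 0 ∧
          ∀ D : Fin n → Fin m × ℝ, IsDataset D →
            (∫ f, empRisk ℓ f D ∂(M D)) -
              (⨅ g : {g : Fin m → ℝ // IsMonotone01 g ∧ IsLipFun Lf g}, empRisk ℓ g.1 D) ≤
              C * L * Real.log ((n : ℝ) * m) * (1 + Real.log (ε * n) ^ 2) / (ε * n) := by
  refine ⟨100, by norm_num, fun m hm ℓ L hℓ Lf hLf n hn ε hε => ?_⟩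
  have hL : 0 ≤ L := by
    have := (abs_nonneg _).trans (hℓ.2 1 0 0 (by simp) (by simp) (by simp))
    simpa using this
  have hm' : (2 : ℝ) ≤ m := by exact_mod_cast hm
  have hn' : (2 : ℝ) ≤ n := by exact_mod_cast hn
  have hx : 0 < ε * n := mul_pos hε.1 (by linarith)
  have hnm : (4 : ℝ) ≤ n * m := by nlinarith
  have hlogm : Real.log (m + 1) ≤ Real.log (n * m) :=
    Real.log_le_log (by linarith) (by nlinarith)
  have hlog4 : 1 ≤ Real.log ((n : ℝ) * m) := by
    rw [Real.le_log_iff_exp_le (by linarith)]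
    linarith [Real.exp_one_lt_d9]
  by_cases htriv : L = 0 ∨ ε * n ≤ 2
  · obtain ⟨M, h1, h2, h3⟩ := exists_constant_mechanism (m := m) hℓ hL hLf.le
      (by lia : 0 < n) hε.1.le
    refine ⟨M, h1, h2, fun D hD => (h3 D hD).trans ?_⟩
    rcases htriv with rfl | hsmall
    · simp
    · rw [le_div_iff₀ hx]
      have hsq : 1 ≤ 1 + Real.log (ε * n) ^ 2 := by nlinarith [sq_nonneg (Real.log (ε * n))]
      have hprod := one_le_mul_of_one_le_of_one_le hlog4 hsq
      nlinarith [mul_le_mul_of_nonneg_left hprod hL, mul_le_mul_of_nonneg_left hsmall hL]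
  · push Not at htriv
    obtain ⟨hL0, hbig⟩ := htriv
    have hLpos : 0 < L := lt_of_le_of_ne hL (Ne.symm hL0)
    have hl2 := Real.log_two_gt_d9
    have hlx : Real.log 2 < Real.log (ε * n) := Real.log_lt_log two_pos hbig
    set T : ℕ := ⌈Real.log (ε * n) / Real.log 2⌉₊ with hT
    have hTlow : Real.log (ε * n) / Real.log 2 ≤ T := Nat.le_ceil _
    have hq1 : 1 < Real.log (ε * n) / Real.log 2 := by
      rw [one_lt_div (by linarith)]
      exact hlx
    have hTpos : (0 : ℝ) < T := by linarith
    have hTup : (T : ℝ) ≤ 3 * Real.log (ε * n) := by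
      have h1 : (T : ℝ) < Real.log (ε * n) / Real.log 2 + 1 := Nat.ceil_lt_add_one (by linarith)
      have h2 : 2 * (Real.log (ε * n) / Real.log 2) ≤ 3 * Real.log (ε * n) := by
        rw [← mul_div_assoc, div_le_iff₀ (by linarith)]
        nlinarith
      linarith
    have hpow : (1 / 2 : ℝ) ^ T ≤ 1 / (ε * n) := by
      rw [one_div_pow]
      refine one_div_le_one_div_of_le hx ?_
      rw [div_le_iff₀ (by linarith), ← Real.log_pow] at hTlow
      exact (Real.log_le_log_iff hx (by positivity)).1 hTlow
    obtain ⟨M, h1, h2, h3⟩ := exists_lipschitz_isotonic_mechanism (m := m) hℓ hLpos hLf.le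
      (by lia : 0 < n) (div_pos hε.1 hTpos) T
    rw [mul_div_cancel₀ _ hTpos.ne'] at h2
    refine ⟨M, h1, h2, fun D hD => (h3 D hD).trans ?_⟩
    have hε0 := hε.1.ne'
    have hn0 : (n : ℝ) ≠ 0 := by linarith
    have hmain : (T : ℝ) * (8 * L * Real.log (m + 1) / (n * (ε / T)))
        = 8 * L * Real.log (m + 1) * T ^ 2 / (ε * n) := by
      field_simp
    have hT2 : (T : ℝ) ^ 2 ≤ 9 * Real.log (ε * n) ^ 2 := by nlinarith
    have hstep : L * Real.log (m + 1) * (T : ℝ) ^ 2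
        ≤ L * Real.log (n * m) * (9 * Real.log (ε * n) ^ 2) := by
      gcongr
    calc (T : ℝ) * (8 * L * Real.log (m + 1) / (n * (ε / T))) + L * (1 / 2) ^ T
        ≤ 8 * L * Real.log (m + 1) * T ^ 2 / (ε * n) + L * (1 / (ε * n)) := by
          rw [hmain]
          gcongr
      _ = (8 * (L * Real.log (m + 1) * T ^ 2) + L) / (ε * n) := by ring
      _ ≤ _ := by
          gcongr
          have h5 : 0 ≤ L * Real.log (n * m) * Real.log (ε * n) ^ 2 := by positivity
          nlinarith [mul_le_mul_of_nonneg_left hlog4 hL]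
end
end

section
/- There is a universal constant C > 0 such that the following holds. Let X = {1,...,m} with the usual total order, m ≥ 2, let ℓ : [0,1]×[0,1] → ℝ≥0 be an L-Lipschitz loss function, let k ≥ 1 be an integer, let n ≥ 2 and ε ∈ (0,1]. Then there exists a randomized algorithm M mapping each dataset D ∈ (X×[0,1])^n to a probability distribution over functions f : X → [0,1] that are monotone and k-piecewise constant, such that M is ε-differentially private and for every dataset D, E_{f∼M(D)}[L_ℓ(f;D)] − min over monotone k-piecewise constant g : X → [0,1] of L_ℓ(g;D) is at most C · L · log(nm) · (1 + log²(εn)) / (εn). -/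
open MeasureTheory

noncomputable section

/-- `f : {1,…,m} → ℝ` is `k`-piecewise constant: the domain can be partitioned into at
most `k` intervals on each of which `f` is constant (witnessed by a monotone labeling
`t : Fin m → Fin k` whose level sets are intervals, with `f` constant on each). -/
def IsPiecewiseConst (k : ℕ) {m : ℕ} (f : Fin m → ℝ) : Prop :=
  ∃ t : Fin m → Fin k, Monotone t ∧ ∀ x y : Fin m, t x = t y → f x = f y

section Softmin

variable {C : Type*} [Fintype C]

/-- The free energy `-(1/lam) * log ∑ exp (-lam * q c)`, a smooth lower bound for `min q`. -/
def softmin (lam : ℝ) (q : C → ℝ) : ℝ :=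
  -(Real.log (∑ c, Real.exp (-(lam * q c))) / lam)

/-- The probability that the exponential mechanism with scores `q` selects `c`. -/
def gibbs (lam : ℝ) (q : C → ℝ) (c : C) : ℝ :=
  Real.exp (-(lam * (q c - softmin lam q)))

lemma gibbs_pos (lam : ℝ) (q : C → ℝ) (c : C) : 0 < gibbs lam q c := Real.exp_pos _

lemma softmin_le {lam : ℝ} (hlam : 0 < lam) (q : C → ℝ) (c : C) : softmin lam q ≤ q c := by
  have h1 : Real.exp (-(lam * q c)) ≤ ∑ c, Real.exp (-(lam * q c)) :=
    Finset.single_le_sum (f := fun c => Real.exp (-(lam * q c)))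
      (fun _ _ => (Real.exp_pos _).le) (Finset.mem_univ c)
  have h2 := Real.log_le_log (Real.exp_pos _) h1
  rw [Real.log_exp] at h2
  rw [softmin, ← neg_div, div_le_iff₀ hlam]
  linarith

lemma mul_softmin {lam : ℝ} (hlam : 0 < lam) (q : C → ℝ) :
    lam * softmin lam q = -Real.log (∑ c, Real.exp (-(lam * q c))) := by
  rw [softmin]
  field_simp

variable [Nonempty C]

lemma partition_pos (lam : ℝ) (q : C → ℝ) : 0 < ∑ c, Real.exp (-(lam * q c)) :=
  Finset.sum_pos (fun _ _ => Real.exp_pos _) Finset.univ_nonempty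

lemma softmin_le_softmin_add {lam : ℝ} (hlam : 0 < lam) {q q' : C → ℝ} {t : ℝ}
    (h : ∀ c, q' c ≤ q c + t) : softmin lam q' ≤ softmin lam q + t := by
  have h1 : Real.exp (-(lam * t)) * ∑ c, Real.exp (-(lam * q c))
      ≤ ∑ c, Real.exp (-(lam * q' c)) := by
    rw [Finset.mul_sum]
    refine Finset.sum_le_sum fun c _ => ?_
    rw [← Real.exp_add, Real.exp_le_exp]
    nlinarith [h c]
  have h2 := Real.log_le_log (mul_pos (Real.exp_pos _) (partition_pos lam q)) h1
  rw [Real.log_mul (Real.exp_pos _).ne' (partition_pos lam q).ne', Real.log_exp] at h2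
  have h3 := mul_softmin hlam q
  have h4 := mul_softmin hlam q'
  refine le_of_mul_le_mul_left ?_ hlam
  linarith

lemma sum_gibbs {lam : ℝ} (hlam : 0 < lam) (q : C → ℝ) : ∑ c, gibbs lam q c = 1 := by
  have h : ∀ c, gibbs lam q c
      = Real.exp (-(lam * q c)) / ∑ c, Real.exp (-(lam * q c)) := fun c => by
    rw [gibbs, mul_sub, mul_softmin hlam, eq_div_iff (partition_pos lam q).ne']
    conv_lhs => rw [← Real.exp_log (partition_pos lam q)]
    rw [← Real.exp_add, Real.log_exp]
    congr 1
    ring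
  simp_rw [h]
  rw [← Finset.sum_div, div_self (partition_pos lam q).ne']

lemma sum_gibbs_mul_le {lam : ℝ} (hlam : 0 < lam) (q : C → ℝ) :
    ∑ c, gibbs lam q c * q c ≤ softmin lam q + Real.log (Fintype.card C) / lam := by
  have hN : (0 : ℝ) < Fintype.card C := by exact_mod_cast Fintype.card_pos
  have key : ∀ c, gibbs lam q c * (lam * (q c - softmin lam q) - Real.log (Fintype.card C))
      ≤ 1 / Fintype.card C - gibbs lam q c := fun c => by
    have h1 := Real.add_one_le_exp
      (lam * (q c - softmin lam q) - Real.log (Fintype.card C))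
    have h2 := mul_le_mul_of_nonneg_left h1 (gibbs_pos lam q c).le
    have h3 : gibbs lam q c
        * Real.exp (lam * (q c - softmin lam q) - Real.log (Fintype.card C))
        = 1 / Fintype.card C := by
      rw [gibbs, ← Real.exp_add, one_div]
      conv_rhs => rw [← Real.exp_log hN, ← Real.exp_neg]
      congr 1
      ring
    linarith
  have hsum := Finset.sum_le_sum fun c (_ : c ∈ Finset.univ) => key c
  have e1 : ∑ c, gibbs lam q c * (lam * (q c - softmin lam q) - Real.log (Fintype.card C))
      = lam * ∑ c, gibbs lam q c * q c
        - (lam * softmin lam q + Real.log (Fintype.card C)) * ∑ c, gibbs lam q c := by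
    rw [Finset.mul_sum, Finset.mul_sum, ← Finset.sum_sub_distrib]
    exact Finset.sum_congr rfl fun c _ => by ring
  rw [e1, Finset.sum_sub_distrib, sum_gibbs hlam, Finset.sum_const, Finset.card_univ,
    nsmul_eq_mul, mul_one_div_cancel hN.ne'] at hsum
  refine le_of_mul_le_mul_left ?_ hlam
  rw [mul_add, mul_div_cancel₀ _ hlam.ne']
  linarith

end Softmin

section Tree

variable {m : ℕ}

/-- A node of the recursion: a set of domain points and the number of values allowed on it. -/
abbrev Node (m : ℕ) : Type := Finset (Fin m) × ℕ

/-- A threshold, and the number of values allotted to the points below it. -/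
abbrev Choice (m : ℕ) : Type := Fin (m + 1) × Fin (m + 1)

/-- A node can be labelled at all: it has no points, or at least one value is allowed. -/
def Feasible (s : Node m) : Prop := s.1 = ∅ ∨ 1 ≤ s.2

/-- The points of `s` below the chosen threshold, with their allotment of values. -/
def lowerPart (s : Node m) (c : Choice m) : Node m :=
  (s.1.filter fun x => (x : ℕ) < c.1, c.2)

/-- The points of `s` above the chosen threshold, with the remaining values. -/
def upperPart (s : Node m) (c : Choice m) : Node m :=
  (s.1.filter fun x => ¬ (x : ℕ) < c.1, s.2 - c.2)

open Classical in
/-- The two children of a node; an infeasible choice keeps every point in the lower child. -/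
def children (s : Node m) (c : Choice m) : Node m × Node m :=
  if (c.2 : ℕ) ≤ s.2 ∧ Feasible (lowerPart s c) ∧ Feasible (upperPart s c) then
    (lowerPart s c, upperPart s c)
  else (s, (∅, 0))

lemma children_union (s : Node m) (c : Choice m) :
    (children s c).1.1 ∪ (children s c).2.1 = s.1 := by
  unfold children
  split_ifs
  · exact Finset.filter_union_filter_not_eq _ _
  · simp

lemma children_lt (s : Node m) (c : Choice m) {x y : Fin m} (hx : x ∈ (children s c).1.1)
    (hy : y ∈ (children s c).2.1) : x < y := by
  unfold children at hx hy
  split_ifs at hx hy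
  · simp only [lowerPart, upperPart, Finset.mem_filter] at hx hy
    rw [Fin.lt_def]
    omega
  · simp at hy

lemma children_disjoint (s : Node m) (c : Choice m) :
    Disjoint (children s c).1.1 (children s c).2.1 :=
  Finset.disjoint_left.2 fun _ hx hy => lt_irrefl _ (children_lt s c hx hy)

lemma children_budget (s : Node m) (c : Choice m) :
    (children s c).1.2 + (children s c).2.2 ≤ s.2 := by
  unfold children
  split_ifs with h
  · simp only [lowerPart, upperPart]
    omega
  · simp

lemma children_feasible {s : Node m} (hs : Feasible s) (c : Choice m) :
    Feasible (children s c).1 ∧ Feasible (children s c).2 := by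
  unfold children
  split_ifs with h
  · exact h.2
  · exact ⟨hs, Or.inl rfl⟩

lemma sum_children (s : Node m) (c : Choice m) (f : Fin m → ℝ) :
    ∑ x ∈ (children s c).1.1, f x + ∑ x ∈ (children s c).2.1, f x = ∑ x ∈ s.1, f x := by
  rw [← Finset.sum_union (children_disjoint s c), children_union]

/-- The indicator of `x ∈ I`, as a real number. -/
def memInd (I : Finset (Fin m)) (x : Fin m) : ℝ := if x ∈ I then 1 else 0

lemma memInd_nonneg (I : Finset (Fin m)) (x : Fin m) : 0 ≤ memInd I x := by
  unfold memInd
  split_ifs <;> norm_num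

lemma memInd_children (s : Node m) (c : Choice m) (x : Fin m) :
    memInd (children s c).1.1 x + memInd (children s c).2.1 x = memInd s.1 x := by
  have := sum_children s c fun y => if x = y then 1 else 0
  simpa [memInd] using this

/-- The free energy of a node at height `d` whose values range over `[a, a + 2 ^ d)`, where `W x v`
is the cost of giving the value `v` to the point `x`. -/
def energy (β : ℝ) (W : Fin m → ℕ → ℝ) : ℕ → Node m → ℕ → ℝ
  | 0, s, a => ∑ x ∈ s.1, W x a
  | d + 1, s, a => softmin (β / 2 ^ (d + 1)) fun c =>
      energy β W d (children s c).1 a + energy β W d (children s c).2 (a + 2 ^ d)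

/-- The score of a choice: the total free energy of the resulting children. -/
def score (β : ℝ) (W : Fin m → ℕ → ℝ) (d : ℕ) (s : Node m) (a : ℕ) (c : Choice m) : ℝ :=
  energy β W d (children s c).1 a + energy β W d (children s c).2 (a + 2 ^ d)

lemma energy_succ (β : ℝ) (W : Fin m → ℕ → ℝ) (d : ℕ) (s : Node m) (a : ℕ) :
    energy β W (d + 1) s a = softmin (β / 2 ^ (d + 1)) (score β W d s a) := rfl

/-- The choices made in a complete binary tree of height `d`. -/
def Transcript (m : ℕ) : ℕ → Type
  | 0 => Unit
  | d + 1 => Choice m × Transcript m d × Transcript m d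

instance transcriptFintype (m : ℕ) : (d : ℕ) → Fintype (Transcript m d)
  | 0 => inferInstanceAs (Fintype Unit)
  | d + 1 =>
    letI := transcriptFintype m d
    inferInstanceAs (Fintype (Choice m × Transcript m d × Transcript m d))

lemma sum_transcript_succ (d : ℕ) (f : Choice m × Transcript m d × Transcript m d → ℝ) :
    (∑ ω : Transcript m (d + 1), f ω) = ∑ c, ∑ ωl, ∑ ωr, f (c, ωl, ωr) := by
  change (∑ ω : Choice m × Transcript m d × Transcript m d, f ω) = _
  rw [Fintype.sum_prod_type]
  exact Finset.sum_congr rfl fun c _ => Fintype.sum_prod_type _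

/-- The labelling encoded by a transcript. -/
def labelling : (d : ℕ) → Node m → ℕ → Transcript m d → Fin m → ℕ
  | 0, _, a, _ => fun _ => a
  | d + 1, s, a, (c, ωl, ωr) => fun x =>
      if x ∈ (children s c).1.1 then labelling d (children s c).1 a ωl x
      else labelling d (children s c).2 (a + 2 ^ d) ωr x

lemma labelling_lower (d : ℕ) (s : Node m) (a : ℕ) (c : Choice m) (ωl ωr : Transcript m d)
    {x : Fin m} (hx : x ∈ (children s c).1.1) :
    labelling (d + 1) s a (c, ωl, ωr) x = labelling d (children s c).1 a ωl x :=
  if_pos hx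

lemma labelling_upper (d : ℕ) (s : Node m) (a : ℕ) (c : Choice m) (ωl ωr : Transcript m d)
    {x : Fin m} (hx : x ∈ (children s c).2.1) : labelling (d + 1) s a (c, ωl, ωr) x
      = labelling d (children s c).2 (a + 2 ^ d) ωr x :=
  if_neg fun h => lt_irrefl _ (children_lt s c h hx)

/-- The probability of a transcript when all choices are made by the exponential mechanism. -/
def weight (β : ℝ) (W : Fin m → ℕ → ℝ) : (d : ℕ) → Node m → ℕ → Transcript m d → ℝ
  | 0, _, _, _ => 1
  | d + 1, s, a, (c, ωl, ωr) => gibbs (β / 2 ^ (d + 1)) (score β W d s a) c *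
      (weight β W d (children s c).1 a ωl * weight β W d (children s c).2 (a + 2 ^ d) ωr)

lemma weight_nonneg (β : ℝ) (W : Fin m → ℕ → ℝ) (d : ℕ) (s : Node m) (a : ℕ)
    (ω : Transcript m d) : 0 ≤ weight β W d s a ω := by
  induction d generalizing s a with
  | zero => exact zero_le_one
  | succ d ih =>
    obtain ⟨c, ωl, ωr⟩ := ω
    exact mul_nonneg (gibbs_pos _ _ _).le (mul_nonneg (ih _ _ _) (ih _ _ _))

lemma sum_weight {β : ℝ} (hβ : 0 < β) (W : Fin m → ℕ → ℝ) (d : ℕ) (s : Node m) (a : ℕ) :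
    ∑ ω, weight β W d s a ω = 1 := by
  induction d generalizing s a with
  | zero => exact (Finset.sum_const (1 : ℝ)).trans (one_smul ℕ (1 : ℝ))
  | succ d ih =>
    refine (sum_transcript_succ d _).trans ?_
    simp only [weight]
    simp_rw [← Finset.mul_sum, ih, mul_one, ih, mul_one]
    exact sum_gibbs (by positivity) _

lemma labelling_spec (d : ℕ) {s : Node m} (hs : Feasible s) (a : ℕ) (ω : Transcript m d) :
    MonotoneOn (labelling d s a ω) s.1 ∧
      (∀ x ∈ s.1, a ≤ labelling d s a ω x ∧ labelling d s a ω x < a + 2 ^ d) ∧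
      (s.1.image (labelling d s a ω)).card ≤ s.2 := by
  induction d generalizing s a with
  | zero =>
    refine ⟨fun _ _ _ _ _ => le_rfl, fun x _ => ⟨le_rfl, ?_⟩, ?_⟩
    · simp [labelling]
    · rcases hs with h | h
      · simp [h]
      · refine le_trans ?_ h
        refine (Finset.card_le_card (t := {a}) ?_).trans (by simp)
        intro y hy
        simp only [labelling, Finset.mem_image] at hy
        obtain ⟨_, _, rfl⟩ := hy
        simp
  | succ d ih =>
    obtain ⟨c, ωl, ωr⟩ := ω
    obtain ⟨hl, hr⟩ := children_feasible hs c
    obtain ⟨l1, l2, l3⟩ := ih hl a ωl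
    obtain ⟨r1, r2, r3⟩ := ih hr (a + 2 ^ d) ωr
    have hpow : 2 ^ (d + 1) = 2 ^ d + 2 ^ d := by ring
    have hL : ∀ x ∈ (children s c).1.1,
        labelling (d + 1) s a (c, ωl, ωr) x = labelling d (children s c).1 a ωl x :=
      fun x hx => labelling_lower d s a c ωl ωr hx
    have hR : ∀ x ∈ (children s c).2.1, labelling (d + 1) s a (c, ωl, ωr) x
        = labelling d (children s c).2 (a + 2 ^ d) ωr x :=
      fun x hx => labelling_upper d s a c ωl ωr hx
    have hmem : ∀ x ∈ s.1, x ∈ (children s c).1.1 ∨ x ∈ (children s c).2.1 := fun x hx => by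
      rw [← children_union s c] at hx
      exact Finset.mem_union.1 hx
    refine ⟨fun x hx y hy hxy => ?_, fun x hx => ?_, ?_⟩
    · rcases hmem x hx with hx | hx <;> rcases hmem y hy with hy | hy
      · rw [hL x hx, hL y hy]
        exact l1 hx hy hxy
      · rw [hL x hx, hR y hy]
        exact (l2 x hx).2.le.trans (r2 y hy).1
      · exact absurd hxy (not_le.2 (children_lt s c hy hx))
      · rw [hR x hx, hR y hy]
        exact r1 hx hy hxy
    · rcases hmem x hx with hx | hx
      · rw [hL x hx]
        have := l2 x hx
        omega
      · rw [hR x hx]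
        have := r2 x hx
        omega
    · have hun : s.1.image (labelling (d + 1) s a (c, ωl, ωr))
          = (children s c).1.1.image (labelling d (children s c).1 a ωl)
            ∪ (children s c).2.1.image (labelling d (children s c).2 (a + 2 ^ d) ωr) := by
        rw [← Finset.image_congr hL, ← Finset.image_congr hR, ← Finset.image_union,
          children_union]
      rw [hun]
      exact (Finset.card_union_le _ _).trans
        ((add_le_add l3 r3).trans (children_budget s c))

lemma energy_le_sum {β : ℝ} (hβ : 0 < β) (W : Fin m → ℕ → ℝ) (d : ℕ) (s : Node m) (a : ℕ)
    (h : Fin m → ℕ) (hmono : MonotoneOn h s.1)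
    (hrange : ∀ x ∈ s.1, a ≤ h x ∧ h x < a + 2 ^ d) (hcard : (s.1.image h).card ≤ s.2)
    (hm : s.2 ≤ m) : energy β W d s a ≤ ∑ x ∈ s.1, W x (h x) := by
  induction d generalizing s a with
  | zero =>
    refine (Finset.sum_congr rfl fun x hx => ?_).le
    have : h x = a := by
      have := hrange x hx
      simp only [pow_zero] at this
      omega
    rw [this]
  | succ d ih =>
    have hpow : 2 ^ (d + 1) = 2 ^ d + 2 ^ d := by ring
    set L := s.1.filter fun x => h x < a + 2 ^ d with hL
    set R := s.1.filter fun x => ¬ h x < a + 2 ^ d with hR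
    have hLs : L ⊆ s.1 := Finset.filter_subset _ _
    have hRs : R ⊆ s.1 := Finset.filter_subset _ _
    have hα : L.sup (fun x => (x : ℕ) + 1) < m + 1 :=
      Nat.lt_succ_of_le (Finset.sup_le fun x _ => x.2)
    have hcards : (L.image h).card + (R.image h).card ≤ s.2 := by
      rw [← Finset.card_union_of_disjoint]
      · refine (Finset.card_le_card ?_).trans hcard
        exact Finset.union_subset (Finset.image_subset_image hLs)
          (Finset.image_subset_image hRs)
      · rw [Finset.disjoint_left]
        intro v hv hv'
        obtain ⟨x, hx, rfl⟩ := Finset.mem_image.1 hv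
        obtain ⟨y, hy, hxy⟩ := Finset.mem_image.1 hv'
        exact (Finset.mem_filter.1 hy).2 (hxy ▸ (Finset.mem_filter.1 hx).2)
    have hj : (L.image h).card < m + 1 := by omega
    set c : Choice m := (⟨_, hα⟩, ⟨_, hj⟩) with hc
    have hiff : ∀ x ∈ s.1, ((x : ℕ) < c.1 ↔ h x < a + 2 ^ d) := fun x hx => by
      constructor
      · intro hlt
        obtain ⟨y, hy, hxy⟩ := (Finset.lt_sup_iff).1 hlt
        have hxy' : x ≤ y := by
          rw [Fin.le_def]
          omega
        exact (hmono hx (hLs hy) hxy').trans_lt (Finset.mem_filter.1 hy).2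
      · intro hlt
        exact Nat.lt_of_succ_le
          (Finset.le_sup (f := fun x : Fin m => (x : ℕ) + 1) (Finset.mem_filter.2 ⟨hx, hlt⟩))
    have hlow : lowerPart s c = (L, (L.image h).card) :=
      Prod.ext (Finset.filter_congr hiff) rfl
    have hup : upperPart s c = (R, s.2 - (L.image h).card) :=
      Prod.ext (Finset.filter_congr fun x hx => not_congr (hiff x hx)) rfl
    have hfeas : ∀ (A : Finset (Fin m)) (k : ℕ), (A.image h).card ≤ k →
        Feasible ((A, k) : Node m) := fun A k hk => by
      rcases A.eq_empty_or_nonempty with h0 | h0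
      · exact Or.inl h0
      · exact Or.inr ((Finset.card_pos.2 (h0.image h)).trans_le hk)
    have hch : children s c = ((L, (L.image h).card), (R, s.2 - (L.image h).card)) := by
      unfold children
      rw [hlow, hup, if_pos]
      exact ⟨by simp only [hc]; omega, hfeas _ _ le_rfl, hfeas _ _ (by omega)⟩
    rw [energy_succ]
    refine (softmin_le (by positivity) _ c).trans ?_
    rw [← sum_children s c, score, hch]
    refine add_le_add
      (ih (L, _) a (hmono.mono hLs) (fun x hx => ⟨(hrange x (hLs hx)).1, ?_⟩) le_rfl
        (by simp only; omega))
      (ih (R, _) _ (hmono.mono hRs) (fun x hx => ⟨?_, ?_⟩) (by simp only; omega)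
        (by simp only; omega))
    · exact (Finset.mem_filter.1 hx).2
    · exact not_lt.1 (Finset.mem_filter.1 hx).2
    · have := (hrange x (hRs hx)).2
      omega

lemma sum_weight_mul_le {β : ℝ} (hβ : 0 < β) (W : Fin m → ℕ → ℝ) (d : ℕ) (s : Node m) (a : ℕ) :
    ∑ ω, weight β W d s a ω * ∑ x ∈ s.1, W x (labelling d s a ω x)
      ≤ energy β W d s a + d * 2 ^ d * (Real.log (Fintype.card (Choice m)) / β) := by
  induction d generalizing s a with
  | zero =>
    have : ∑ ω, weight β W 0 s a ω * ∑ x ∈ s.1, W x (labelling 0 s a ω x)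
        = (∑ ω, weight β W 0 s a ω) * energy β W 0 s a := by
      rw [Finset.sum_mul]
      rfl
    rw [this, sum_weight hβ]
    simp
  | succ d ih =>
    refine (sum_transcript_succ d _).trans_le ?_
    have hsplit : ∀ c ωl ωr, ∑ x ∈ s.1, W x (labelling (d + 1) s a (c, ωl, ωr) x)
        = ∑ x ∈ (children s c).1.1, W x (labelling d (children s c).1 a ωl x)
          + ∑ x ∈ (children s c).2.1, W x (labelling d (children s c).2 (a + 2 ^ d) ωr x) := by
      intro c ωl ωr
      rw [← sum_children s c]
      congr 1
      · exact Finset.sum_congr rfl fun x hx => congrArg (W x) (labelling_lower d s a c ωl ωr hx)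
      · exact Finset.sum_congr rfl fun x hx => congrArg (W x) (labelling_upper d s a c ωl ωr hx)
    have hprod : ∀ (p f : Transcript m d → ℝ) (p' f' : Transcript m d → ℝ) (g : ℝ),
        ∑ ω, p ω = 1 → ∑ ω, p' ω = 1 →
        ∑ ωl, ∑ ωr, g * (p ωl * p' ωr) * (f ωl + f' ωr)
          = g * (∑ ω, p ω * f ω + ∑ ω, p' ω * f' ω) := by
      intro p f p' f' g hp hp'
      have : ∀ ωl ωr, g * (p ωl * p' ωr) * (f ωl + f' ωr)
          = g * (p ωl * f ωl) * p' ωr + g * p ωl * (p' ωr * f' ωr) := fun _ _ => by ring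
      simp_rw [this, Finset.sum_add_distrib, ← Finset.mul_sum, hp', mul_one, ← Finset.sum_mul,
        ← Finset.mul_sum, hp]
      ring
    have hnode := sum_gibbs_mul_le (lam := β / 2 ^ (d + 1)) (by positivity) (score β W d s a)
    calc _ = ∑ c, gibbs (β / 2 ^ (d + 1)) (score β W d s a) c *
          (∑ ω, weight β W d (children s c).1 a ω *
              ∑ x ∈ (children s c).1.1, W x (labelling d (children s c).1 a ω x)
            + ∑ ω, weight β W d (children s c).2 (a + 2 ^ d) ω *
              ∑ x ∈ (children s c).2.1, W x (labelling d (children s c).2 (a + 2 ^ d) ω x)) := by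
          refine Finset.sum_congr rfl fun c _ => ?_
          simp_rw [hsplit, weight]
          exact hprod _ _ _ _ _ (sum_weight hβ _ _ _ _) (sum_weight hβ _ _ _ _)
      _ ≤ ∑ c, gibbs (β / 2 ^ (d + 1)) (score β W d s a) c * (score β W d s a c
            + 2 * (d * 2 ^ d * (Real.log (Fintype.card (Choice m)) / β))) := by
          refine Finset.sum_le_sum fun c _ =>
            mul_le_mul_of_nonneg_left ?_ (gibbs_pos _ _ _).le
          have h1 := ih (children s c).1 a
          have h2 := ih (children s c).2 (a + 2 ^ d)
          rw [score]
          linarith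
      _ ≤ _ := by
          simp_rw [mul_add, Finset.sum_add_distrib, ← Finset.sum_mul]
          rw [sum_gibbs (by positivity), energy_succ]
          refine (add_le_add_left hnode _).trans (le_of_eq ?_)
          push_cast
          field_simp
          ring

/-- `W'` is obtained from `W` by adding one sample at `x₀` with cost function `φ`. -/
def AddsPoint (W W' : Fin m → ℕ → ℝ) (x₀ : Fin m) (φ : ℕ → ℝ) : Prop :=
  ∀ x v, W' x v = W x v + if x = x₀ then φ v else 0

lemma AddsPoint.symm {W W' : Fin m → ℕ → ℝ} {x₀ : Fin m} {φ : ℕ → ℝ}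
    (h : AddsPoint W W' x₀ φ) : AddsPoint W' W x₀ (-φ) := fun x v => by
  rw [h x v]
  split_ifs <;> simp

lemma score_le_of_energy_le {β Λ : ℝ} {W W' : Fin m → ℕ → ℝ} {x₀ : Fin m} {φ : ℕ → ℝ}
    (hφ : ∀ u v : ℕ, φ u - φ v ≤ Λ * |(u : ℝ) - v|) {d : ℕ}
    (ih : ∀ (s : Node m) (a : ℕ),
      energy β W' d s a ≤ energy β W d s a + memInd s.1 x₀ * (φ a + Λ * 2 ^ d))
    (s : Node m) (a : ℕ) (c : Choice m) :
    score β W' d s a c ≤ score β W d s a c + memInd s.1 x₀ * (φ a + Λ * 2 ^ (d + 1)) := by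
  have h1 := ih (children s c).1 a
  have h2 := ih (children s c).2 (a + 2 ^ d)
  have h3 := hφ (a + 2 ^ d) a
  have h4 : |((a + 2 ^ d : ℕ) : ℝ) - a| = 2 ^ d := by
    push_cast
    rw [add_sub_cancel_left, abs_of_nonneg (by positivity)]
  have h5 := hφ a a
  have h6 := hφ a (a + 2 ^ d)
  rw [h4] at h3
  have hΛ : 0 ≤ Λ * 2 ^ d := by
    rw [abs_sub_comm, h4] at h6
    linarith
  rw [← memInd_children s c x₀, score, score, pow_succ]
  have n1 := memInd_nonneg (children s c).1.1 x₀
  have n2 := memInd_nonneg (children s c).2.1 x₀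
  have e1 := mul_nonneg n1 hΛ
  have e2 := mul_le_mul_of_nonneg_left h3 n2
  linarith

lemma energy_le_of_addsPoint {β Λ : ℝ} (hβ : 0 < β) {W W' : Fin m → ℕ → ℝ} {x₀ : Fin m}
    {φ : ℕ → ℝ} (hW : AddsPoint W W' x₀ φ) (hΛ : 0 ≤ Λ)
    (hφ : ∀ u v : ℕ, φ u - φ v ≤ Λ * |(u : ℝ) - v|) (d : ℕ) (s : Node m) (a : ℕ) :
    energy β W' d s a ≤ energy β W d s a + memInd s.1 x₀ * (φ a + Λ * 2 ^ d) := by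
  induction d generalizing s a with
  | zero =>
    simp only [energy, hW _ _, Finset.sum_add_distrib, Finset.sum_ite_eq', memInd]
    split_ifs
    · simp [hΛ]
    · simp
  | succ d ih =>
    exact softmin_le_softmin_add (by positivity) (score_le_of_energy_le hφ ih s a)

lemma weight_le_of_addsPoint {β Λ : ℝ} (hβ : 0 < β) {W W' : Fin m → ℕ → ℝ} {x₀ : Fin m}
    {φ : ℕ → ℝ} (hW : AddsPoint W W' x₀ φ) (hΛ : 0 ≤ Λ)
    (hφ : ∀ u v : ℕ, φ u - φ v ≤ Λ * |(u : ℝ) - v|) (d : ℕ) (s : Node m) (a : ℕ)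
    (ω : Transcript m d) :
    weight β W d s a ω
      ≤ Real.exp (d * (2 * β * Λ) * memInd s.1 x₀) * weight β W' d s a ω := by
  have hφ' : ∀ u v : ℕ, (-φ) u - (-φ) v ≤ Λ * |(u : ℝ) - v| := fun u v => by
    have := hφ v u
    rw [abs_sub_comm] at this
    simp only [Pi.neg_apply]
    linarith
  induction d generalizing s a with
  | zero => simp [weight]
  | succ d ih =>
    obtain ⟨c, ωl, ωr⟩ := ω
    have hq := score_le_of_energy_le hφ (energy_le_of_addsPoint hβ hW hΛ hφ d) s a c
    have hV := energy_le_of_addsPoint hβ hW.symm hΛ hφ' (d + 1) s a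
    rw [energy_succ, energy_succ, Pi.neg_apply] at hV
    have hg : gibbs (β / 2 ^ (d + 1)) (score β W d s a) c
        ≤ Real.exp (2 * β * Λ * memInd s.1 x₀)
          * gibbs (β / 2 ^ (d + 1)) (score β W' d s a) c := by
      rw [gibbs, gibbs, ← Real.exp_add, Real.exp_le_exp]
      have hlam : 0 < β / 2 ^ (d + 1) := by positivity
      have h1 := mul_le_mul_of_nonneg_left (add_le_add hq hV) hlam.le
      have h2 : β / 2 ^ (d + 1) * (memInd s.1 x₀ * (2 * (Λ * 2 ^ (d + 1))))
          = 2 * β * Λ * memInd s.1 x₀ := by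
        field_simp
      linarith
    have hl := ih (children s c).1 a ωl
    have hr := ih (children s c).2 (a + 2 ^ d) ωr
    simp only [weight]
    have hn := weight_nonneg β W
    have hn' := weight_nonneg β W'
    refine (mul_le_mul hg (mul_le_mul hl hr (hn _ _ _ _)
      (mul_nonneg (Real.exp_pos _).le (hn' _ _ _ _))) (mul_nonneg (hn _ _ _ _) (hn _ _ _ _))
      (mul_nonneg (Real.exp_pos _).le (gibbs_pos _ _ _).le)).trans (le_of_eq ?_)
    have he : Real.exp ((d + 1 : ℕ) * (2 * β * Λ) * memInd s.1 x₀)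
        = Real.exp (2 * β * Λ * memInd s.1 x₀)
          * (Real.exp (d * (2 * β * Λ) * memInd (children s c).1.1 x₀)
            * Real.exp (d * (2 * β * Λ) * memInd (children s c).2.1 x₀)) := by
      rw [← Real.exp_add, ← Real.exp_add, ← memInd_children s c x₀]
      congr 1
      push_cast
      ring
    rw [he]
    ring

end Tree

section Mechanism

variable {m : ℕ}

/-- The dyadic grid of `[0, 1]` with mesh `2 ^ (-T)`. -/
def grid (T v : ℕ) : ℝ := min ((v : ℝ) / 2 ^ T) 1

lemma grid_mem (T v : ℕ) : grid T v ∈ Set.Icc (0 : ℝ) 1 :=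
  ⟨le_min (by positivity) zero_le_one, min_le_right _ _⟩

lemma grid_mono (T : ℕ) : Monotone (grid T) := fun u v h => by
  unfold grid
  gcongr

lemma abs_grid_sub_le (T u v : ℕ) : |grid T u - grid T v| ≤ |(u : ℝ) - v| / 2 ^ T := by
  unfold grid
  refine (abs_min_sub_min_le_max _ _ _ _).trans ?_
  rw [← sub_div, abs_div, sub_self, abs_zero, abs_of_pos (by positivity : (0 : ℝ) < 2 ^ T)]
  exact max_le le_rfl (by positivity)

/-- The largest natural number `v` with `v / 2 ^ T < y` (and `0` when `y = 0`). -/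
def roundDown (T : ℕ) (y : ℝ) : ℕ := ⌈2 ^ T * y⌉₊ - 1

lemma roundDown_mono (T : ℕ) : Monotone (roundDown T) := fun u v h =>
  Nat.sub_le_sub_right (Nat.ceil_mono (by gcongr)) 1

lemma roundDown_lt (T : ℕ) {y : ℝ} (hy : y ≤ 1) : roundDown T y < 2 ^ T := by
  have h1 : ⌈2 ^ T * y⌉₊ ≤ 2 ^ T := by
    rw [Nat.ceil_le]
    push_cast
    exact mul_le_of_le_one_right (by positivity) hy
  have h2 : 0 < 2 ^ T := by positivity
  unfold roundDown
  omega

lemma abs_grid_roundDown_sub_le (T : ℕ) {y : ℝ} (hy : y ∈ Set.Icc (0 : ℝ) 1) :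
    |grid T (roundDown T y) - y| ≤ 1 / 2 ^ T := by
  have hpos : (0 : ℝ) < 2 ^ T := by positivity
  have hlt : (roundDown T y : ℝ) ≤ 2 ^ T := by exact_mod_cast (roundDown_lt T hy.2).le
  have hgrid : grid T (roundDown T y) = roundDown T y / 2 ^ T :=
    min_eq_left ((div_le_one hpos).2 hlt)
  have hnn : 0 ≤ 2 ^ T * y := mul_nonneg hpos.le hy.1
  have hup : (roundDown T y : ℝ) ≤ 2 ^ T * y := by
    unfold roundDown
    rcases Nat.eq_zero_or_pos ⌈2 ^ T * y⌉₊ with h | h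
    · rw [h]
      simpa using hnn
    · rw [Nat.cast_sub h]
      have := Nat.ceil_lt_add_one hnn
      push_cast
      linarith
  have hlow : 2 ^ T * y ≤ roundDown T y + 1 := by
    refine (Nat.le_ceil _).trans ?_
    unfold roundDown
    exact_mod_cast le_tsub_add
  rw [hgrid, show (roundDown T y : ℝ) / 2 ^ T - y = (roundDown T y - 2 ^ T * y) / 2 ^ T by
    field_simp, abs_div, abs_of_pos hpos]
  gcongr
  rw [abs_le]
  constructor <;> linarith

lemma isPiecewiseConst_of_card_le {k : ℕ} {f : Fin m → ℝ} (hf : Monotone f)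
    (hk : (Finset.univ.image f).card ≤ k) : IsPiecewiseConst k f := by
  have hlt : ∀ x y, f x < f y → ((Finset.univ.image f).filter (· < f x)).card
      < ((Finset.univ.image f).filter (· < f y)).card := fun x y hxy => by
    refine Finset.card_lt_card ((Finset.ssubset_iff_of_subset ?_).2 ⟨f x, ?_, ?_⟩)
    · exact Finset.monotone_filter_right _ fun z _ hz => lt_trans hz hxy
    · simp [hxy]
    · simp
  refine ⟨fun x => ⟨((Finset.univ.image f).filter (· < f x)).card, ?_⟩, fun x y hxy => ?_,
    fun x y hxy => ?_⟩
  · refine lt_of_lt_of_le (Finset.card_lt_card ?_) hk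
    exact (Finset.ssubset_iff_of_subset (Finset.filter_subset _ _)).2 ⟨f x, by simp, by simp⟩
  · rw [Fin.mk_le_mk]
    exact Finset.card_le_card
      (Finset.monotone_filter_right _ fun z _ hz => lt_of_lt_of_le hz (hf hxy))
  · rw [Fin.mk_eq_mk] at hxy
    rcases lt_trichotomy (f x) (f y) with h | h | h
    · exact absurd hxy (hlt x y h).ne
    · exact h
    · exact absurd hxy (hlt y x h).ne'

lemma IsPiecewiseConst.card_image_comp_le {k : ℕ} {f : Fin m → ℝ} (hf : IsPiecewiseConst k f)
    (r : ℝ → ℕ) : (Finset.univ.image fun x => r (f x)).card ≤ min k m := by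
  refine le_min ?_ (Finset.card_image_le.trans (by simp))
  obtain ⟨t, -, ht⟩ := hf
  have hinj : ∀ v ∈ Finset.univ.image (fun x => r (f x)), ∃ x, r (f x) = v := fun v hv => by
    simpa using hv
  rcases isEmpty_or_nonempty (Fin m) with hm | hm
  · simp
  choose! p hp using hinj
  have := Finset.card_le_card_of_injOn (s := Finset.univ.image fun x => r (f x))
    (t := (Finset.univ : Finset (Fin k))) (fun v => t (p v)) (fun _ _ => by simp)
    (fun u hu v hv huv => by
      rw [← hp u hu, ← hp v hv, ht _ _ huv])
  simpa using this

variable {n : ℕ}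

/-- The total loss incurred by giving the point `x` the `v`-th grid value. -/
def cost (ℓ : ℝ → ℝ → ℝ) (T : ℕ) (D : Fin n → Fin m × ℝ) (x : Fin m) (v : ℕ) : ℝ :=
  ∑ i, if x = (D i).1 then ℓ (grid T v) (D i).2 else 0

lemma sum_cost (ℓ : ℝ → ℝ → ℝ) (T : ℕ) (D : Fin n → Fin m × ℝ) (h : Fin m → ℕ) :
    ∑ x, cost ℓ T D x (h x) = ∑ i, ℓ (grid T (h (D i).1)) (D i).2 := by
  unfold cost
  rw [Finset.sum_comm]
  simp

/-- Loss of the samples other than the `i`-th. -/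
def costErase (ℓ : ℝ → ℝ → ℝ) (T : ℕ) (D : Fin n → Fin m × ℝ) (i : Fin n) (x : Fin m)
    (v : ℕ) : ℝ :=
  ∑ j ∈ Finset.univ.erase i, if x = (D j).1 then ℓ (grid T v) (D j).2 else 0

lemma addsPoint_costErase (ℓ : ℝ → ℝ → ℝ) (T : ℕ) (D : Fin n → Fin m × ℝ) (i : Fin n) :
    AddsPoint (costErase ℓ T D i) (cost ℓ T D) (D i).1 fun v => ℓ (grid T v) (D i).2 :=
  fun _ _ => (Finset.sum_erase_add _ _ (Finset.mem_univ i)).symm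

lemma weight_cost_le {ℓ : ℝ → ℝ → ℝ} {L : ℝ} (hℓ : IsLipschitzLoss ℓ L) (hL : 0 ≤ L) {β : ℝ}
    (hβ : 0 < β) (T : ℕ) {D D' : Fin n → Fin m × ℝ} (hD : NeighborDS D D') (s : Node m) (a : ℕ)
    (ω : Transcript m T) :
    weight β (cost ℓ T D) T s a ω
      ≤ Real.exp (4 * T * β * (L / 2 ^ T)) * weight β (cost ℓ T D') T s a ω := by
  obtain ⟨h1, h2, i, hi⟩ := hD
  have hΛ : 0 ≤ L / 2 ^ T := by positivity
  have hlip : ∀ z ∈ Set.Icc (0 : ℝ) 1, ∀ u v : ℕ,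
      ℓ (grid T u) z - ℓ (grid T v) z ≤ L / 2 ^ T * |(u : ℝ) - v| := fun z hz u v => by
    refine (le_abs_self _).trans ((hℓ.2 _ _ _ (grid_mem T u) (grid_mem T v) hz).trans ?_)
    refine (mul_le_mul_of_nonneg_left (abs_grid_sub_le T u v) hL).trans (le_of_eq ?_)
    ring
  have herase : costErase ℓ T D i = costErase ℓ T D' i := by
    funext x v
    exact Finset.sum_congr rfl fun j hj => by rw [hi j (Finset.ne_of_mem_erase hj)]
  have hrem := weight_le_of_addsPoint hβ (addsPoint_costErase ℓ T D i).symm hΛ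
    (fun u v => by
      have := hlip _ (h1 i) v u
      rw [abs_sub_comm] at this
      simp only [Pi.neg_apply]
      linarith) T s a ω
  have hadd := weight_le_of_addsPoint hβ (addsPoint_costErase ℓ T D' i) hΛ
    (hlip _ (h2 i)) T s a ω
  rw [herase] at hrem
  have hind : ∀ x, Real.exp (T * (2 * β * (L / 2 ^ T)) * memInd s.1 x)
      ≤ Real.exp (T * (2 * β * (L / 2 ^ T))) := fun x => by
    rw [Real.exp_le_exp]
    refine mul_le_of_le_one_right (by positivity) ?_
    unfold memInd
    split_ifs <;> norm_num
  have hn := weight_nonneg β (cost ℓ T D') T s a ω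
  have hn' := weight_nonneg β (costErase ℓ T D' i) T s a ω
  calc _ ≤ _ := hrem
    _ ≤ Real.exp (T * (2 * β * (L / 2 ^ T))) * (Real.exp (T * (2 * β * (L / 2 ^ T)))
        * weight β (cost ℓ T D') T s a ω) :=
      mul_le_mul (hind _) (hadd.trans (mul_le_mul_of_nonneg_right (hind _) hn)) hn'
        (Real.exp_pos _).le
    _ = _ := by
      rw [← mul_assoc, ← Real.exp_add]
      congr 2
      ring

/-- The root of the recursion: all points, and at most `k` values. -/
def root (m k : ℕ) : Node m := (Finset.univ, min k m)

/-- The function on `Fin m` encoded by a transcript. -/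
def outputFun (k T : ℕ) (ω : Transcript m T) (x : Fin m) : ℝ :=
  grid T (labelling T (root m k) 0 ω x)

/-- The recursive exponential mechanism for isotonic regression with at most `k` values. -/
def isoMechanism (ℓ : ℝ → ℝ → ℝ) (β : ℝ) (k T : ℕ) (D : Fin n → Fin m × ℝ) :
    Measure (Fin m → ℝ) :=
  ∑ ω : Transcript m T, ENNReal.ofReal (weight β (cost ℓ T D) T (root m k) 0 ω) •
    Measure.dirac (outputFun k T ω)

lemma outputFun_good {k T : ℕ} (hk : 1 ≤ k) (ω : Transcript m T) :
    IsMonotone01 (outputFun k T ω) ∧ IsPiecewiseConst k (outputFun k T ω) := by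
  have hfeas : Feasible (root m k) := by
    rcases Nat.eq_zero_or_pos m with rfl | hm
    · exact Or.inl (Finset.univ_eq_empty)
    · exact Or.inr (le_min hk hm)
  obtain ⟨h1, -, h3⟩ := labelling_spec T hfeas 0 ω
  have hmono : Monotone (outputFun k T ω) := fun x y hxy =>
    grid_mono T (h1 (by simp [root]) (by simp [root]) hxy)
  refine ⟨⟨hmono, fun x => grid_mem _ _⟩, isPiecewiseConst_of_card_le hmono ?_⟩
  have : Finset.univ.image (outputFun k T ω)
      = (Finset.univ.image (labelling T (root m k) 0 ω)).image (grid T) := by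
    rw [Finset.image_image]
    rfl
  rw [this]
  exact Finset.card_image_le.trans (h3.trans (min_le_left _ _))

lemma sum_ofReal_weight (ℓ : ℝ → ℝ → ℝ) {β : ℝ} (hβ : 0 < β) (k T : ℕ)
    (D : Fin n → Fin m × ℝ) :
    ∑ ω : Transcript m T, ENNReal.ofReal (weight β (cost ℓ T D) T (root m k) 0 ω) = 1 := by
  rw [← ENNReal.ofReal_sum_of_nonneg fun ω _ => weight_nonneg _ _ _ _ _ _, sum_weight hβ,
    ENNReal.ofReal_one]

lemma isoMechanism_apply_of_forall_mem (ℓ : ℝ → ℝ → ℝ) {β : ℝ} (hβ : 0 < β) (k T : ℕ)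
    (D : Fin n → Fin m × ℝ) {S : Set (Fin m → ℝ)} (hS : ∀ ω, outputFun k T ω ∈ S) :
    isoMechanism ℓ β k T D S = 1 := by
  rw [← sum_ofReal_weight ℓ hβ k T D, isoMechanism, Measure.finsetSum_apply]
  exact Finset.sum_congr rfl fun ω _ => by
    rw [Measure.smul_apply, Measure.dirac_apply_of_mem (hS ω), smul_eq_mul, mul_one]

lemma isDP_isoMechanism {ℓ : ℝ → ℝ → ℝ} {L : ℝ} (hℓ : IsLipschitzLoss ℓ L) (hL : 0 ≤ L) {β : ℝ}
    (hβ : 0 < β) (k T : ℕ) :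
    IsDP (NeighborDS (X := Fin m) (n := n)) (isoMechanism ℓ β k T)
      (4 * T * β * (L / 2 ^ T)) 0 := by
  intro D D' hD S _
  rw [ENNReal.ofReal_zero, add_zero, isoMechanism, isoMechanism, Measure.finsetSum_apply,
    Measure.finsetSum_apply, Finset.mul_sum]
  refine Finset.sum_le_sum fun ω _ => ?_
  rw [Measure.smul_apply, Measure.smul_apply, smul_eq_mul, smul_eq_mul, ← mul_assoc,
    ← ENNReal.ofReal_mul (Real.exp_pos _).le]
  gcongr
  exact weight_cost_le hℓ hL hβ T hD _ _ ω

lemma integral_isoMechanism (ℓ : ℝ → ℝ → ℝ) (β : ℝ) (k T : ℕ) (D : Fin n → Fin m × ℝ)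
    (F : (Fin m → ℝ) → ℝ) :
    ∫ f, F f ∂(isoMechanism ℓ β k T D)
      = ∑ ω : Transcript m T, weight β (cost ℓ T D) T (root m k) 0 ω * F (outputFun k T ω) := by
  rw [isoMechanism, integral_finsetSum_measure]
  · refine Finset.sum_congr rfl fun ω _ => ?_
    rw [integral_smul_measure, integral_dirac, ENNReal.toReal_ofReal (weight_nonneg _ _ _ _ _ _),
      smul_eq_mul]
  · intro ω _
    exact (integrable_dirac (by simp)).smul_measure ENNReal.ofReal_ne_top

lemma integral_empRisk_isoMechanism_le {ℓ : ℝ → ℝ → ℝ} {L : ℝ} (hℓ : IsLipschitzLoss ℓ L)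
    (hL : 0 ≤ L) {β : ℝ} (hβ : 0 < β) (hn : 0 < n) (k T : ℕ) {D : Fin n → Fin m × ℝ}
    (hD : IsDataset D) {g : Fin m → ℝ} (hg : IsMonotone01 g) (hgk : IsPiecewiseConst k g) :
    ∫ f, empRisk ℓ f D ∂(isoMechanism ℓ β k T D)
      ≤ empRisk ℓ g D + L / 2 ^ T + T * 2 ^ T * (Real.log (Fintype.card (Choice m)) / β) / n := by
  have hn' : (0 : ℝ) < n := by exact_mod_cast hn
  have hround := energy_le_sum hβ (cost ℓ T D) T (root m k) 0 (fun x => roundDown T (g x))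
    (fun x _ y _ hxy => roundDown_mono T (hg.1 hxy))
    (fun x _ => ⟨Nat.zero_le _, by simpa using roundDown_lt T (hg.2 x).2⟩)
    (hgk.card_image_comp_le _) (min_le_right _ _)
  have hutil := sum_weight_mul_le hβ (cost ℓ T D) T (root m k) 0
  have hmesh : ∑ i, ℓ (grid T (roundDown T (g (D i).1))) (D i).2
      ≤ ∑ i, ℓ (g (D i).1) (D i).2 + n * (L / 2 ^ T) := by
    have : ∀ i, ℓ (grid T (roundDown T (g (D i).1))) (D i).2
        ≤ ℓ (g (D i).1) (D i).2 + L / 2 ^ T := fun i => by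
      have h1 := hℓ.2 _ _ _ (grid_mem T (roundDown T (g (D i).1))) (hg.2 (D i).1) (hD i)
      have h2 := mul_le_mul_of_nonneg_left (abs_grid_roundDown_sub_le T (hg.2 (D i).1)) hL
      rw [mul_one_div] at h2
      linarith [le_abs_self (ℓ (grid T (roundDown T (g (D i).1))) (D i).2
        - ℓ (g (D i).1) (D i).2)]
    refine (Finset.sum_le_sum fun i _ => this i).trans (le_of_eq ?_)
    simp [Finset.sum_add_distrib]
  simp only [root, sum_cost] at hround hutil
  rw [integral_isoMechanism]
  have hlhs : ∑ ω : Transcript m T, weight β (cost ℓ T D) T (root m k) 0 ω *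
        empRisk ℓ (outputFun k T ω) D
      = (∑ ω : Transcript m T, weight β (cost ℓ T D) T (root m k) 0 ω *
        ∑ i, ℓ (grid T (labelling T (root m k) 0 ω (D i).1)) (D i).2) / n := by
    rw [Finset.sum_div]
    refine Finset.sum_congr rfl fun ω _ => ?_
    rw [empRisk]
    simp only [outputFun]
    ring
  rw [hlhs, empRisk, div_le_iff₀ hn']
  refine (hutil.trans (add_le_add_left (hround.trans hmesh) _)).trans (le_of_eq ?_)
  field_simp

end Mechanism

lemma sq_floor_logb_add_one_le (r : ℝ) :
    ((⌊Real.logb 2 r⌋₊ + 1 : ℕ) : ℝ) ^ 2 ≤ 8 * (1 + Real.log r ^ 2) := by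
  have hT : ((⌊Real.logb 2 r⌋₊ + 1 : ℕ) : ℝ) ≤ |Real.logb 2 r| + 1 := by
    push_cast
    gcongr
    exact (Nat.cast_le.2 (Nat.floor_mono (le_abs_self _))).trans (Nat.floor_le (abs_nonneg _))
  have h2 : 0.69 < Real.log 2 := lt_trans (by norm_num) Real.log_two_gt_d9
  have hlog : Real.logb 2 r * Real.log 2 = Real.log r := by
    rw [Real.logb]
    field_simp
  have habs := sq_abs (Real.logb 2 r)
  have h3 : (Real.logb 2 r) ^ 2 ≤ 4 * Real.log r ^ 2 := by
    rw [← hlog, mul_pow]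
    nlinarith [mul_nonneg (sq_nonneg (Real.logb 2 r))
      (by nlinarith : 0 ≤ 4 * Real.log 2 ^ 2 - 1)]
  have h4 : ((⌊Real.logb 2 r⌋₊ + 1 : ℕ) : ℝ) ^ 2 ≤ (|Real.logb 2 r| + 1) ^ 2 := by gcongr
  nlinarith [sq_nonneg (|Real.logb 2 r| - 1)]

lemma lt_two_pow_floor_logb_add_one {r : ℝ} (hr : 0 < r) :
    r < 2 ^ (⌊Real.logb 2 r⌋₊ + 1) := by
  have h := Nat.lt_floor_add_one (Real.logb 2 r)
  rw [Real.logb_lt_iff_lt_rpow (by norm_num) hr] at h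
  exact_mod_cast h

lemma log_card_choice_le {m n : ℕ} (hm : 2 ≤ m) (hn : 2 ≤ n) :
    Real.log (Fintype.card (Choice m)) ≤ 2 * Real.log ((n : ℝ) * m) := by
  have hcard : Fintype.card (Choice m) = (m + 1) ^ 2 := by
    simp [Choice, sq]
  rw [hcard, Nat.cast_pow, Real.log_pow, Nat.cast_two]
  gcongr
  exact_mod_cast (show m + 1 ≤ n * m by nlinarith)

lemma one_le_log_mul {m n : ℕ} (hm : 2 ≤ m) (hn : 2 ≤ n) : 1 ≤ Real.log ((n : ℝ) * m) := by
  rw [Real.le_log_iff_exp_le (by positivity)]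
  have h : (4 : ℝ) ≤ n * m := by exact_mod_cast Nat.mul_le_mul hn hm
  linarith [Real.exp_one_lt_d9]

/-- **`k`-piecewise constant isotonic regression (Theorem 5, piecewise-constant case).**
There is a universal constant `C > 0` such that for `X = {1,…,m}` (here `Fin m`) with
`m ≥ 2`, any `L`-Lipschitz loss `ℓ`, any `k ≥ 1`, `n ≥ 2` and `ε ∈ (0,1]`, there is an
`ε`-DP mechanism outputting monotone `k`-piecewise-constant functions whose expected
excess empirical risk relative to the best such function is at most
`C · L · log(nm) · (1 + log²(εn)) / (εn)`. -/
theorem dp_piecewise_constant_isotonic_regression_upper_bound :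
    ∃ C : ℝ, 0 < C ∧
      ∀ m : ℕ, 2 ≤ m →
        ∀ (ℓ : ℝ → ℝ → ℝ) (L : ℝ), IsLipschitzLoss ℓ L →
        ∀ k : ℕ, 1 ≤ k →
        ∀ n : ℕ, 2 ≤ n →
        ∀ ε : ℝ, ε ∈ Set.Ioc (0 : ℝ) 1 →
        ∃ M : (Fin n → Fin m × ℝ) → Measure (Fin m → ℝ),
          (∀ D : Fin n → Fin m × ℝ, IsDataset D →
            IsProbabilityMeasure (M D) ∧
              M D {f | IsMonotone01 f ∧ IsPiecewiseConst k f} = 1) ∧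
          IsDP NeighborDS M ε 0 ∧
          ∀ D : Fin n → Fin m × ℝ, IsDataset D →
            (∫ f, empRisk ℓ f D ∂(M D)) -
              (⨅ g : {g : Fin m → ℝ // IsMonotone01 g ∧ IsPiecewiseConst k g},
                empRisk ℓ g.1 D) ≤
              C * L * Real.log ((n : ℝ) * m) * (1 + Real.log (ε * n) ^ 2) / (ε * n) := by
  refine ⟨65, by norm_num, ?_⟩
  intro m hm ℓ L hℓ k hk n hn ε hε
  have hε0 : 0 < ε := hε.1
  have hn0 : 0 < n := by omega
  have hnR : (0 : ℝ) < n := by exact_mod_cast hn0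
  have hL : 0 ≤ L := by
    have := hℓ.2 0 1 0 (by simp) (by simp) (by simp)
    norm_num at this
    exact (abs_nonneg _).trans this
  have hlogpos := one_le_log_mul hm hn
  have hconst : IsMonotone01 (fun _ : Fin m => (0 : ℝ)) ∧
      IsPiecewiseConst k (fun _ : Fin m => (0 : ℝ)) :=
    ⟨⟨monotone_const, fun _ => by simp⟩, fun _ => ⟨0, hk⟩, monotone_const, fun _ _ _ => rfl⟩
  have : Nonempty {g : Fin m → ℝ // IsMonotone01 g ∧ IsPiecewiseConst k g} := ⟨⟨_, hconst⟩⟩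
  rcases hL.eq_or_lt with rfl | hLpos
  · refine ⟨fun _ => Measure.dirac fun _ => 0, fun D _ =>
      ⟨inferInstance, Measure.dirac_apply_of_mem hconst⟩, fun D D' _ S _ => ?_, fun D hD => ?_⟩
    · rw [ENNReal.ofReal_zero, add_zero]
      refine le_mul_of_one_le_left zero_le (ENNReal.one_le_ofReal.2 (Real.one_le_exp hε0.le))
    · have hle : empRisk ℓ (fun _ => 0) D ≤
          ⨅ g : {g : Fin m → ℝ // IsMonotone01 g ∧ IsPiecewiseConst k g}, empRisk ℓ g.1 D := by
        refine le_ciInf fun g => le_of_eq ?_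
        unfold empRisk
        congr 1
        refine Finset.sum_congr rfl fun i _ => ?_
        have := hℓ.2 0 (g.1 (D i).1) (D i).2 (by simp) (g.2.1.2 _) (hD i)
        rw [zero_mul] at this
        exact sub_eq_zero.1 (abs_nonpos_iff.1 this)
      rw [integral_dirac]
      simpa using hle
  · have hr : 0 < ε * n := by positivity
    set T := ⌊Real.logb 2 (ε * n)⌋₊ + 1 with hT
    have hTpos : (0 : ℝ) < T := by
      rw [hT]
      positivity
    have hT2 : (T : ℝ) ^ 2 ≤ 8 * (1 + Real.log (ε * n) ^ 2) := sq_floor_logb_add_one_le _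
    have hpow : ε * n < 2 ^ T := lt_two_pow_floor_logb_add_one hr
    set β := ε * 2 ^ T / (4 * T * L) with hβdef
    have hβ : 0 < β := by positivity
    have hbudget : 4 * T * β * (L / 2 ^ T) = ε := by
      rw [hβdef]
      field_simp
    refine ⟨isoMechanism ℓ β k T, fun D _ => ⟨⟨?_⟩, ?_⟩, ?_, fun D hD => ?_⟩
    · exact isoMechanism_apply_of_forall_mem ℓ hβ k T D fun _ => Set.mem_univ _
    · exact isoMechanism_apply_of_forall_mem ℓ hβ k T D fun ω => outputFun_good hk ω
    · rw [← hbudget]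
      exact isDP_isoMechanism hℓ hL hβ k T
    · rw [sub_le_iff_le_add, ← sub_le_iff_le_add']
      refine le_ciInf fun g => ?_
      have hrisk := integral_empRisk_isoMechanism_le hℓ hL hβ hn0 k T hD g.2.1 g.2.2
      have hmesh : L / 2 ^ T ≤ L / (ε * n) := by gcongr
      have hsearch : T * 2 ^ T * (Real.log (Fintype.card (Choice m)) / β) / n
          ≤ 64 * L * Real.log ((n : ℝ) * m) * (1 + Real.log (ε * n) ^ 2) / (ε * n) := by
        have : T * 2 ^ T * (Real.log (Fintype.card (Choice m)) / β) / n
            = 4 * L * (Real.log (Fintype.card (Choice m)) * (T : ℝ) ^ 2) / (ε * n) := by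
          rw [hβdef]
          field_simp
        rw [this]
        refine div_le_div_of_nonneg_right ?_ hr.le
        have hlc := mul_le_mul (log_card_choice_le hm hn) hT2 (by positivity) (by positivity)
        nlinarith [mul_le_mul_of_nonneg_left hlc hL]
      have hone : L / (ε * n)
          ≤ L * Real.log ((n : ℝ) * m) * (1 + Real.log (ε * n) ^ 2) / (ε * n) := by
        gcongr
        rw [mul_assoc]
        exact le_mul_of_one_le_right hL
          (one_le_mul_of_one_le_of_one_le hlogpos (by linarith [sq_nonneg (Real.log (ε * n))]))
      have hsum : 65 * (L * Real.log ((n : ℝ) * m) * (1 + Real.log (ε * n) ^ 2) / (ε * n))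
          = 65 * L * Real.log ((n : ℝ) * m) * (1 + Real.log (ε * n) ^ 2) / (ε * n) := by ring
      have h64 : 64 * L * Real.log ((n : ℝ) * m) * (1 + Real.log (ε * n) ^ 2) / (ε * n)
          = 64 * (L * Real.log ((n : ℝ) * m) * (1 + Real.log (ε * n) ^ 2) / (ε * n)) := by ring
      linarith
end
end
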